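/- arXiv:2012.08964 — 3 statements merged into one kernel-verified Lean document; each statement's English description precedes it below -/
import Mathlib

section
/- Quantitative Fractional Helly Theorem (volume version): There is a universal constant c > 0 such that for every dimension d ≥ 1 and every α ∈ (0,1) there exists β ∈ (0,1) with the following property. Let 𝒞 be a finite family of n ≥ 3d+1 convex sets in ℝ^d such that among all subfamilies of 𝒞 of size 3d+1, at least α · C(n, 3d+1) subfamilies have the property that the intersection of their 3d+1 members has Lebesgue measure (volume) at least one. Then there is a subfamily 𝒞′ ⊆ 𝒞 of size at least β·n such that the intersection of all members of 𝒞′ has volume at least d^(−c·d²). -/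
open MeasureTheory

/-- A dense family of `(k+1)`-sets in which every member has a distinguished vertex contains many
members sharing the complement of their distinguished vertex. -/
theorem exists_common_erase {n k : ℕ} (hn : k + 1 ≤ n) {α : ℝ} (hα : 0 ≤ α)
    (𝒯 : Finset (Finset (Fin n))) (hcard : ∀ T ∈ 𝒯, T.card = k + 1)
    (h𝒯 : α * (n.choose (k + 1) : ℝ) ≤ (𝒯.card : ℝ))
    (R : Finset (Fin n) → Fin n → Prop) (hR : ∀ T ∈ 𝒯, ∃ i ∈ T, R (T.erase i) i) :
    ∃ (S : Finset (Fin n)) (I : Finset (Fin n)),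
      α / ((k : ℝ) + 1) ^ 2 * n ≤ (I.card : ℝ) ∧ ∀ i ∈ I, R S i := by
  classical
  have : Nonempty (Fin n) := ⟨⟨0, by omega⟩⟩
  choose! v hvT hvR using hR
  have hmaps : ∀ T ∈ 𝒯, T.erase (v T) ∈ Finset.powersetCard k (Finset.univ : Finset (Fin n)) := by
    intro T hT
    simp [Finset.mem_powersetCard, Finset.card_erase_of_mem (hvT T hT), hcard T hT]
  have hk : (0 : ℝ) < (k : ℝ) + 1 := by positivity
  have hchoose : (n.choose (k + 1) : ℝ) * (k + 1) = n.choose k * ((n : ℝ) - k) := by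
    have h := Nat.choose_succ_right_eq n k
    rw [← Nat.cast_sub (by omega : k ≤ n)]
    exact_mod_cast h
  have hne : (Finset.powersetCard k (Finset.univ : Finset (Fin n))).Nonempty := by
    rw [Finset.powersetCard_nonempty]
    simp; omega
  obtain ⟨S, -, hS⟩ := Finset.exists_le_card_fiber_of_nsmul_le_card_of_maps_to
    (M := ℝ) (b := α * ((n : ℝ) - k) / (k + 1)) hmaps hne (by
      rw [nsmul_eq_mul, Finset.card_powersetCard, Finset.card_univ, Fintype.card_fin]
      refine le_trans (le_of_eq ?_) h𝒯
      field_simp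
      linear_combination -α * hchoose)
  refine ⟨S, ({T ∈ 𝒯 | T.erase (v T) = S} : Finset _).image v, ?_, ?_⟩
  · rw [Finset.card_image_of_injOn]
    · refine le_trans ?_ hS
      rw [div_mul_eq_mul_div, div_le_div_iff₀ (by positivity) hk]
      have hn' : (k : ℝ) + 1 ≤ n := by exact_mod_cast hn
      have h1 : (n : ℝ) ≤ (n - k) * (k + 1) := by nlinarith [Nat.cast_nonneg (α := ℝ) k]
      have := mul_le_mul_of_nonneg_left h1 (mul_nonneg hα hk.le)
      nlinarith
    · intro T hT T' hT' h
      simp only [Finset.coe_filter, Set.mem_ofPred_eq] at hT hT'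
      rw [← Finset.insert_erase (hvT T hT.1), ← Finset.insert_erase (hvT T' hT'.1), hT.2, hT'.2, h]
  · intro i hi
    obtain ⟨T, hT, rfl⟩ := Finset.mem_image.1 hi
    obtain ⟨hT', rfl⟩ := Finset.mem_filter.1 hT
    exact hvR T hT'

section Auerbach

variable {E : Type*} [NormedAddCommGroup E] [NormedSpace ℝ E] [FiniteDimensional ℝ E]

/-- A compact spanning set contains a basis in which all its elements have coordinates bounded
by one. -/
theorem IsCompact.exists_basis_abs_coord_le_one {d : ℕ} (hd : Module.finrank ℝ E = d)
    {X : Set E} (hX : IsCompact X) (hspan : Submodule.span ℝ X = ⊤) :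
    ∃ u : Fin d → E, (∀ k, u k ∈ X) ∧
      ∀ y ∈ X, ∃ a : Fin d → ℝ, (∀ k, |a k| ≤ 1) ∧ y = ∑ k, a k • u k := by
  classical
  let e : Module.Basis (Fin d) ℝ E := Module.finBasisOfFinrankEq ℝ E hd
  have hcont : Continuous fun v : Fin d → E => |e.det v| := by
    have : ⇑e.det =
        fun v => Matrix.det (Matrix.of fun i j => e.coord i (v j)) := by
      ext v
      rw [Module.Basis.det_apply]
      rfl
    refine continuous_abs.comp ?_
    rw [this]
    refine Continuous.matrix_det ?_
    refine continuous_matrix fun i j => ?_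
    exact (LinearMap.continuous_of_finiteDimensional (e.coord i)).comp (continuous_apply j)
  let b := Module.Basis.ofSpan (K := ℝ) (s := X) hspan.ge
  let b' := b.reindex (b.indexEquiv e)
  have hb' : ∀ k, b' k ∈ X := fun k => Module.Basis.ofSpan_subset hspan.ge (by simp [b', b])
  obtain ⟨u, huX, humax⟩ := (isCompact_univ_pi fun _ : Fin d => hX).exists_isMaxOn
    ⟨b', fun k _ => hb' k⟩ hcont.continuousOn
  have hu0 : e.det u ≠ 0 := by
    have h := humax (show ⇑b' ∈ Set.univ.pi fun _ => X from fun k _ => hb' k)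
    have h' : 0 < |e.det b'| := abs_pos.2 (e.isUnit_det b').ne_zero
    exact abs_pos.1 (h'.trans_le h)
  obtain ⟨hli, hsp⟩ := (Module.Basis.is_basis_iff_det e).2 (isUnit_iff_ne_zero.2 hu0)
  refine ⟨u, fun k => huX k trivial, fun y hy => ⟨fun k => (Module.Basis.mk hli hsp.ge).coord k y,
    fun k => ?_, ?_⟩⟩
  · have h := LinearMap.congr_fun (e.det_smul_mk_coord_eq_det_update hli hsp.ge k) y
    have h' : e.det u * (Module.Basis.mk hli hsp.ge).coord k y = e.det (Function.update u k y) := h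
    have hm : |e.det (Function.update u k y)| ≤ |e.det u| := by
      refine humax (show Function.update u k y ∈ Set.univ.pi fun _ => X from fun j _ => ?_)
      by_cases hj : j = k
      · subst hj; simpa using hy
      · simpa [hj] using huX j trivial
    rw [← h', abs_mul] at hm
    have := abs_pos.2 hu0
    exact le_of_mul_le_mul_left (by linarith) this
  · have := (Module.Basis.mk hli hsp.ge).sum_repr y
    simpa using this.symm

end Auerbach

section Center

variable {E : Type*} [AddCommGroup E] [Module ℝ E] [TopologicalSpace E] [T2Space E]
  [IsTopologicalAddGroup E] [ContinuousSMul ℝ E] [FiniteDimensional ℝ E]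

/-- Every infinite compact convex set in dimension `d` has a point `c` about which its `-1/d`
homothetic copy is contained in the set. -/
theorem Convex.exists_center {K : Set E} (hc : Convex ℝ K) (hK : IsCompact K) (hinf : K.Infinite)
    (hd : 0 < Module.finrank ℝ E) :
    ∃ c ∈ K, ∀ x ∈ K, c + (1 / (Module.finrank ℝ E : ℝ)) • (c - x) ∈ K := by
  classical
  set d := Module.finrank ℝ E with hdd
  have hd' : (0 : ℝ) < d := by exact_mod_cast hd
  let F : K → Set E := fun x =>
    (fun k => (1 / ((d : ℝ) + 1)) • (x : E) + ((d : ℝ) / (d + 1)) • k) '' K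
  have : Infinite K := hinf.to_subtype
  obtain ⟨c, hcF⟩ := Convex.helly_theorem_compact (𝕜 := ℝ) (F := F) (by simp)
    (fun x => hc.affinity _ _) (fun x => hK.image (by fun_prop)) (by
      intro I hI
      refine ⟨∑ z ∈ I, (1 / ((d : ℝ) + 1)) • (z : E), Set.mem_iInter₂.2 fun x hx => ?_⟩
      refine ⟨∑ z ∈ I.erase x, (1 / (d : ℝ)) • (z : E), ?_, ?_⟩
      · refine hc.sum_mem (fun _ _ => by positivity) ?_ (fun z _ => z.2)
        rw [Finset.sum_const, Finset.card_erase_of_mem hx, hI, nsmul_eq_mul]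
        push_cast
        rw [← hdd]
        simp
        field_simp
      · rw [← Finset.add_sum_erase I _ hx]
        dsimp only
        rw [Finset.smul_sum]
        congr 1
        refine Finset.sum_congr rfl fun z _ => ?_
        rw [smul_smul]
        congr 1
        field_simp)
  rw [Set.mem_iInter] at hcF
  refine ⟨c, ?_, fun x hx => ?_⟩
  · obtain ⟨x, hx⟩ := hinf.nonempty
    obtain ⟨k, hk, rfl⟩ := hcF ⟨x, hx⟩
    exact hc hx hk (by positivity) (by positivity) (by field_simp; ring)
  · obtain ⟨k, hk, rfl⟩ := hcF ⟨x, hx⟩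
    convert hk using 1
    match_scalars <;> field_simp <;> ring

end Center

/-- The closed convex hull of a compact subset of an open convex set stays in that set. -/
theorem IsCompact.closure_convexHull_subset {E : Type*} [NormedAddCommGroup E] [NormedSpace ℝ E]
    {L U : Set E} (hL : IsCompact L) (hU : IsOpen U) (hc : Convex ℝ U) (h : L ⊆ U) :
    closure (convexHull ℝ L) ⊆ U := by
  obtain ⟨δ, hδ, hδU⟩ := hL.exists_thickening_subset_open hU h
  refine (Metric.closure_subset_thickening hδ _).trans ?_
  rw [← add_ball_zero, ← (convex_ball (0 : E) δ).convexHull_eq, ← convexHull_add, add_ball_zero]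
  exact convexHull_min hδU hc

section Polar

variable {E : Type*} [NormedAddCommGroup E] [InnerProductSpace ℝ E]

/-- The polar set of `s` with respect to the centre `c`. -/
def polarAt (c : E) (s : Set E) : Set E := {y | ∀ x ∈ s, inner ℝ y (x - c) ≤ 1}

theorem isClosed_polarAt (c : E) (s : Set E) : IsClosed (polarAt c s) := by
  have : polarAt c s = ⋂ x ∈ s, {y | inner ℝ y (x - c) ≤ 1} := by ext; simp [polarAt]
  rw [this]
  exact isClosed_biInter fun x _ => isClosed_le (by fun_prop) continuous_const

theorem isCompact_polarAt [FiniteDimensional ℝ E] {c : E} {s : Set E} (hc : c ∈ interior s) :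
    IsCompact (polarAt c s) := by
  obtain ⟨r, hr, hrs⟩ := Metric.nhds_basis_closedBall.mem_iff.1 (mem_interior_iff_mem_nhds.1 hc)
  refine Metric.isCompact_of_isClosed_isBounded (isClosed_polarAt c s)
    ((Metric.isBounded_closedBall (x := (0 : E)) (r := 1 / r)).subset fun y hy => ?_)
  rw [mem_closedBall_zero_iff, le_div_iff₀ hr]
  rcases eq_or_ne y 0 with rfl | hy0
  · simp
  have hn : 0 < ‖y‖ := norm_pos_iff.2 hy0
  have h := hy (c + (r / ‖y‖) • y) (hrs (by
    rw [mem_closedBall_iff_norm, add_sub_cancel_left, norm_smul, Real.norm_of_nonneg (by positivity)]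
    exact (div_mul_cancel₀ _ hn.ne').le))
  rw [add_sub_cancel_left, inner_smul_right, real_inner_self_eq_norm_sq] at h
  calc ‖y‖ * r = r / ‖y‖ * ‖y‖ ^ 2 := by field_simp
    _ ≤ 1 := h

theorem mem_of_forall_mem_polarAt_inner_le_one [CompleteSpace E] {c : E} {s : Set E}
    (hconv : Convex ℝ s) (hs : IsClosed s) (hc : c ∈ s) {x : E}
    (hx : ∀ y ∈ polarAt c s, inner ℝ y (x - c) ≤ 1) : x ∈ s := by
  by_contra hxs
  obtain ⟨f, t, hft, hfx⟩ := geometric_hahn_banach_closed_point hconv hs hxs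
  have ht : 0 < t - f c := sub_pos.2 (hft c hc)
  have hinner : ∀ z : E, inner ℝ ((1 / (t - f c)) • (InnerProductSpace.toDual ℝ E).symm f) (z - c) =
      (f z - f c) / (t - f c) := fun z => by
    rw [real_inner_smul_left, InnerProductSpace.toDual_symm_apply, map_sub]
    ring
  have h := hx _ fun z hz => by
    rw [hinner, div_le_one ht]
    linarith [hft z hz]
  rw [hinner, div_le_one ht] at h
  linarith

/-- Among more than `2d + 1` compact convex sets whose intersection has nonempty interior, one
contains a large homothetic copy of the intersection of the others. -/
theorem exists_homothety_subset [FiniteDimensional ℝ E] {d : ℕ} (hd : Module.finrank ℝ E = d)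
    (hd0 : 0 < d) {ι : Type*} [DecidableEq ι] (T : Finset ι) (hT : 2 * d + 1 < T.card)
    (D : ι → Set E) (hconv : ∀ i ∈ T, Convex ℝ (D i)) (hcomp : ∀ i ∈ T, IsCompact (D i)) (c : E)
    (hc : c ∈ interior (⋂ i ∈ T, D i))
    (hsym : ∀ x ∈ ⋂ i ∈ T, D i, c + (1 / (d : ℝ)) • (c - x) ∈ ⋂ i ∈ T, D i) :
    ∃ i ∈ T, ∀ p ∈ ⋂ j ∈ T.erase i, D j,
      c + (1 / (3 * (d : ℝ) ^ 3)) • (p - c) ∈ ⋂ i ∈ T, D i := by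
  have hd1 : (1 : ℝ) ≤ d := by exact_mod_cast hd0
  have hcT : ∀ i ∈ T, c ∈ D i := Set.mem_iInter₂.1 (interior_subset hc)
  set X : Set E := ⋃ i ∈ T, polarAt c (D i) with hXdef
  have hX : IsCompact X := T.isCompact_biUnion fun i hi =>
    isCompact_polarAt (interior_mono (Set.biInter_subset_of_mem hi) hc)
  have hmem : ∀ x : E, (∀ y ∈ X, inner ℝ y (x - c) ≤ 1) → x ∈ ⋂ i ∈ T, D i := fun x hx =>
    Set.mem_iInter₂.2 fun i hi => mem_of_forall_mem_polarAt_inner_le_one (hconv i hi)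
      (hcomp i hi).isClosed (hcT i hi) fun y hy => hx y (Set.mem_biUnion hi hy)
  have hXle : ∀ x ∈ ⋂ i ∈ T, D i, ∀ y ∈ X, inner ℝ y (x - c) ≤ 1 := by
    intro x hx y hy
    obtain ⟨i, hi, hy⟩ := Set.mem_iUnion₂.1 hy
    exact hy x (Set.mem_iInter₂.1 hx i hi)
  obtain ⟨i₀, hi₀⟩ : T.Nonempty := Finset.card_pos.1 (by omega)
  have h0X : (0 : E) ∈ X := Set.mem_biUnion hi₀ fun x _ => by simp
  obtain ⟨ρ, hρ⟩ := (T.isCompact_biUnion hcomp).isBounded.subset_closedBall c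
  have hρ' : ∀ i ∈ T, ∀ p ∈ D i, ‖p - c‖ ≤ ρ := fun i hi p hp =>
    mem_closedBall_iff_norm.1 (hρ (Set.mem_biUnion hi hp))
  have hspan : Submodule.span ℝ X = ⊤ := by
    rw [← Submodule.orthogonal_eq_bot_iff]
    by_contra hne
    obtain ⟨x, hx, hx0⟩ := Submodule.exists_mem_ne_zero_of_ne_bot hne
    have hn : 0 < ‖x‖ := norm_pos_iff.2 hx0
    have hmemt : c + ((|ρ| + 1) / ‖x‖) • x ∈ ⋂ i ∈ T, D i := hmem _ fun y hy => by
      rw [add_sub_cancel_left, inner_smul_right,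
        (Submodule.mem_orthogonal _ x).1 hx y (Submodule.subset_span hy)]
      simp
    have h := hρ' i₀ hi₀ _ (Set.mem_iInter₂.1 hmemt i₀ hi₀)
    rw [add_sub_cancel_left, norm_smul, Real.norm_of_nonneg (by positivity),
      div_mul_cancel₀ _ hn.ne'] at h
    linarith [le_abs_self ρ]
  obtain ⟨u, huX, hu⟩ := hX.exists_basis_abs_coord_le_one hd hspan
  set v : E := -(1 / (d : ℝ) ^ 2) • ∑ k, u k with hv
  have hv_inner : ∀ z : E, inner ℝ v z = -(1 / (d : ℝ) ^ 2) * ∑ k, inner ℝ (u k) z := fun z => by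
    rw [hv, real_inner_smul_left, sum_inner]
  have hvmem : v ∈ closure (convexHull ℝ X) := by
    by_contra hvX
    obtain ⟨f, t, hft, hfv⟩ :=
      geometric_hahn_banach_closed_point (convex_convexHull ℝ X).closure isClosed_closure hvX
    have hfX : ∀ y ∈ X, f y < t := fun y hy => hft y (subset_closure (subset_convexHull ℝ X hy))
    have ht : 0 < t := by simpa using hfX 0 h0X
    set z := (InnerProductSpace.toDual ℝ E).symm f with hz
    have hfz : ∀ y, inner ℝ y z = f y := fun y => by
      rw [real_inner_comm, hz, InnerProductSpace.toDual_symm_apply]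
    have hx : c + (1 / t) • z ∈ ⋂ i ∈ T, D i := hmem _ fun y hy => by
      rw [add_sub_cancel_left, inner_smul_right, hfz, one_div_mul_eq_div, div_le_one ht]
      exact (hfX y hy).le
    have huk : ∀ k, -(d * t) ≤ f (u k) := fun k => by
      have h := hXle _ (hsym _ hx) (u k) (huX k)
      rw [add_sub_cancel_left, sub_add_cancel_left, smul_neg, smul_smul, inner_neg_right,
        inner_smul_right, hfz] at h
      have h2 : -(f (u k)) / (d * t) ≤ 1 := by
        refine le_trans (le_of_eq ?_) h
        field_simp
      rw [div_le_one (by positivity)] at h2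
      linarith
    have hsum : -(d * (d * t)) ≤ ∑ k, f (u k) := by
      calc -(d * (d * t)) = ∑ _k : Fin d, -(d * t) := by simp
        _ ≤ _ := Finset.sum_le_sum fun k _ => huk k
    rw [← hfz, hv_inner] at hfv
    simp only [hfz] at hfv
    have : -(1 / (d : ℝ) ^ 2) * ∑ k, f (u k) ≤ t := by
      have h3 := mul_le_mul_of_nonneg_left hsum (show 0 ≤ 1 / (d : ℝ) ^ 2 by positivity)
      have h4 : 1 / (d : ℝ) ^ 2 * -(d * (d * t)) = -t := by field_simp
      linarith
    linarith
  obtain ⟨v', hv', hvv'⟩ := Metric.mem_closure_iff.1 hvmem (1 / (|ρ| + 1)) (by positivity)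
  rw [convexHull_eq_union] at hv'
  simp only [Set.mem_iUnion] at hv'
  obtain ⟨t, htX, hti, hv't⟩ := hv'
  have htcard : t.card ≤ d + 1 := by
    have h := hti.card_le_finrank_succ
    rw [Fintype.card_coe] at h
    exact h.trans (by rw [← hd]; gcongr; exact Submodule.finrank_le _)
  have hg : ∀ y ∈ X, ∃ i ∈ T, y ∈ polarAt c (D i) := fun y hy => by
    simpa using Set.mem_iUnion₂.1 hy
  have : Nonempty ι := ⟨i₀⟩
  choose! g hgT hgp using hg
  classical
  obtain ⟨i, hiT, hi⟩ : ∃ i ∈ T, i ∉ (t ∪ Finset.univ.image u).image g := by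
    refine Finset.exists_mem_notMem_of_card_lt_card ?_
    have h1 := Finset.card_image_le (s := t ∪ Finset.univ.image u) (f := g)
    have h2 := Finset.card_union_le t (Finset.univ.image u)
    have h3 := Finset.card_image_le (s := (Finset.univ : Finset (Fin d))) (f := u)
    rw [Finset.card_univ, Fintype.card_fin] at h3
    omega
  refine ⟨i, hiT, fun p hp => hmem _ fun y hy => ?_⟩
  have hp' : ∀ y ∈ X, y ∈ t ∪ Finset.univ.image u → inner ℝ y (p - c) ≤ 1 := fun y hy hyt =>
    hgp y hy p (Set.mem_iInter₂.1 hp _ (Finset.mem_erase.2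
      ⟨fun h => hi (h ▸ Finset.mem_image_of_mem g hyt), hgT y hy⟩))
  have hup : ∀ k, inner ℝ (u k) (p - c) ≤ 1 := fun k =>
    hp' _ (huX k) (Finset.mem_union_right _ (Finset.mem_image_of_mem u (Finset.mem_univ k)))
  have hpρ : ‖p - c‖ ≤ ρ := by
    have hj : g (u ⟨0, hd0⟩) ∈ T := hgT _ (huX _)
    refine hρ' _ hj p (Set.mem_iInter₂.1 hp _ (Finset.mem_erase.2 ⟨fun h => hi (h ▸ ?_), hj⟩))
    exact Finset.mem_image_of_mem g (Finset.mem_union_right _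
      (Finset.mem_image_of_mem u (Finset.mem_univ _)))
  have hv'p : inner ℝ v' (p - c) ≤ 1 := by
    have hconvex : Convex ℝ {y : E | inner ℝ y (p - c) ≤ 1} := by
      refine convex_halfSpace_le ⟨fun a b => inner_add_left _ _ _, fun a b => ?_⟩ 1
      rw [real_inner_smul_left, smul_eq_mul]
    exact convexHull_min (fun y hy => hp' y (htX hy) (Finset.mem_union_left _ hy)) hconvex hv't
  have hvp : inner ℝ v (p - c) ≤ 2 := by
    have h1 : inner ℝ (v - v') (p - c) ≤ 1 := by
      refine (real_inner_le_norm _ _).trans ?_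
      rw [dist_eq_norm] at hvv'
      calc ‖v - v'‖ * ‖p - c‖ ≤ 1 / (|ρ| + 1) * (|ρ| + 1) := by
            gcongr
            linarith [le_abs_self ρ]
        _ = 1 := by field_simp
    rw [inner_sub_left] at h1
    linarith
  have hsum : -(2 * (d : ℝ) ^ 2) ≤ ∑ k, inner ℝ (u k) (p - c) := by
    rw [hv_inner] at hvp
    have h := mul_le_mul_of_nonneg_left hvp (show 0 ≤ (d : ℝ) ^ 2 by positivity)
    have h4 : (d : ℝ) ^ 2 * (-(1 / (d : ℝ) ^ 2) * ∑ k, inner ℝ (u k) (p - c)) =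
      -∑ k, inner ℝ (u k) (p - c) := by field_simp
    linarith
  have habs : ∀ k, |inner ℝ (u k) (p - c)| ≤ 3 * (d : ℝ) ^ 2 := fun k => by
    have h1 : ∑ j ∈ Finset.univ.erase k, inner ℝ (u j) (p - c) ≤ d := by
      calc _ ≤ ∑ j ∈ Finset.univ.erase k, (1 : ℝ) := Finset.sum_le_sum fun j _ => hup j
        _ ≤ ∑ j : Fin d, (1 : ℝ) :=
          Finset.sum_le_sum_of_subset_of_nonneg (Finset.erase_subset _ _) (by simp)
        _ = d := by simp
    rw [← Finset.add_sum_erase _ _ (Finset.mem_univ k)] at hsum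
    rw [abs_le]
    constructor <;> nlinarith [hup k]
  obtain ⟨a, ha, rfl⟩ := hu y hy
  rw [add_sub_cancel_left, inner_smul_right, sum_inner, one_div_mul_eq_div,
    div_le_one (by positivity)]
  calc ∑ k, inner ℝ (a k • u k) (p - c) ≤ ∑ _k : Fin d, 3 * (d : ℝ) ^ 2 := by
        refine Finset.sum_le_sum fun k _ => ?_
        rw [real_inner_smul_left]
        calc a k * inner ℝ (u k) (p - c) ≤ |a k| * |inner ℝ (u k) (p - c)| := by
              rw [← abs_mul]; exact le_abs_self _
          _ ≤ 1 * (3 * (d : ℝ) ^ 2) := by gcongr <;> first | exact ha k | exact habs k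
          _ = _ := one_mul _
    _ = 3 * (d : ℝ) ^ 3 := by simp; ring

end Polar

open scoped Pointwise in
/-- If many homothetic copies of a compact convex set `P` of ratio `l` have their centres in `P`,
then a positive proportion of them share a translate of `(l / 2) • P`. -/
theorem exists_common_translate {E : Type*} [NormedAddCommGroup E] [NormedSpace ℝ E]
    [FiniteDimensional ℝ E] [MeasurableSpace E] [BorelSpace E] (μ : Measure E) [μ.IsAddHaarMeasure]
    {P : Set E} (hP : Convex ℝ P) (hPc : IsCompact P) (hP0 : μ P ≠ 0) {ι : Type*} (I : Finset ι)
    (c : ι → E) (hc : ∀ i ∈ I, c i ∈ P) {l : ℝ} (hl0 : 0 < l) (hl1 : l ≤ 1) :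
    ∃ (J : Finset ι) (z : E), J ⊆ I ∧ (l / 2) ^ Module.finrank ℝ E * I.card ≤ (J.card : ℝ) ∧
      ∀ i ∈ J, ∀ p ∈ P, ∃ q ∈ P, z + (l / 2) • p = c i + l • (q - c i) := by
  classical
  obtain ⟨p₀, hp₀⟩ : P.Nonempty := nonempty_of_measure_ne_zero hP0
  have hPt : μ P ≠ ⊤ := hPc.measure_lt_top.ne
  let A : ι → Set E := fun i => (fun p => ((1 - l) • c i + (l / 2) • p₀) + p) '' ((l / 2) • P)
  have hAc : ∀ i, IsCompact (A i) := fun i => (hPc.smul _).image (by fun_prop)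
  have hAP : ∀ i ∈ I, A i ⊆ P := by
    rintro i hi _ ⟨_, ⟨p, hp, rfl⟩, rfl⟩
    have h1 : (1 / 2 : ℝ) • p₀ + (1 / 2 : ℝ) • p ∈ P :=
      hP hp₀ hp (by norm_num) (by norm_num) (by norm_num)
    have h2 := hP (hc i hi) h1 (sub_nonneg.2 hl1) hl0.le (by ring)
    convert h2 using 1
    dsimp only
    module
  have hμA : ∀ i, μ (A i) = ENNReal.ofReal ((l / 2) ^ Module.finrank ℝ E) * μ P := fun i => by
    simp only [A, Set.image_add_left, measure_preimage_add, Measure.addHaar_smul]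
    rw [abs_of_nonneg (by positivity)]
  let f : E → ENNReal := fun y => ∑ i ∈ I, (A i).indicator 1 y
  have hint : ∫⁻ y in P, f y ∂μ =
      I.card * (ENNReal.ofReal ((l / 2) ^ Module.finrank ℝ E) * μ P) := by
    rw [lintegral_finsetSum _ fun i _ => measurable_one.indicator (hAc i).measurableSet]
    rw [Finset.sum_congr rfl (g := fun _ => ENNReal.ofReal ((l / 2) ^ Module.finrank ℝ E) * μ P)]
    · simp
    · intro i hi
      rw [lintegral_indicator_one (hAc i).measurableSet,
        Measure.restrict_apply (hAc i).measurableSet, Set.inter_eq_left.2 (hAP i hi), hμA]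
  obtain ⟨y, hyP, hy⟩ := exists_setLAverage_le hP0 hPc.measurableSet.nullMeasurableSet (f := f) (by
    rw [hint]
    exact ENNReal.mul_ne_top (by simp) (ENNReal.mul_ne_top (by simp) hPt))
  refine ⟨{i ∈ I | y ∈ A i}, y - (l / 2) • p₀, Finset.filter_subset _ _, ?_, ?_⟩
  · rw [setLAverage_eq, hint, ← mul_assoc, ENNReal.mul_div_cancel_right hP0 hPt] at hy
    have hf : f y = (({i ∈ I | y ∈ A i} : Finset ι).card : ENNReal) := by
      simp [f, Set.indicator_apply, Finset.sum_boole]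
    rw [hf, ← ENNReal.ofReal_natCast, ← ENNReal.ofReal_natCast,
      ← ENNReal.ofReal_mul (by positivity), ENNReal.ofReal_le_ofReal_iff (by positivity)] at hy
    rwa [mul_comm]
  · intro i hi p hp
    obtain ⟨_, ⟨q, hq, rfl⟩, rfl⟩ := (Finset.mem_filter.1 hi).2
    refine ⟨(1 / 2 : ℝ) • q + (1 / 2 : ℝ) • p,
      hP hq hp (by norm_num) (by norm_num) (by norm_num), ?_⟩
    dsimp only
    module

/-- Finitely many convex sets can be shrunk to compact convex sets so that prescribed
intersections of measure at least one keep measure more than one half. -/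
theorem exists_compact_convex_subsets {E : Type*} [NormedAddCommGroup E] [NormedSpace ℝ E]
    [FiniteDimensional ℝ E] [MeasurableSpace E] [BorelSpace E] (μ : Measure E) [μ.IsAddHaarMeasure]
    {ι : Type*} [Finite ι] (C : ι → Set E) (hC : ∀ i, Convex ℝ (C i)) (𝒯 : Finset (Finset ι))
    (h𝒯 : ∀ T ∈ 𝒯, 1 ≤ μ (⋂ i ∈ T, C i)) :
    ∃ D : ι → Set E, (∀ i, D i ⊆ C i ∧ Convex ℝ (D i) ∧ IsCompact (D i)) ∧
      ∀ T ∈ 𝒯, ENNReal.ofReal (1 / 2) ≤ μ (⋂ i ∈ T, D i) := by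
  classical
  have hL : ∀ T ∈ 𝒯, ∃ L ⊆ interior (⋂ i ∈ T, C i), IsCompact L ∧
      ENNReal.ofReal (1 / 2) < μ L := by
    intro T hT
    refine isOpen_interior.exists_lt_isCompact ?_
    have hconv : Convex ℝ (⋂ i ∈ T, C i) := convex_iInter₂ fun i _ => hC i
    calc ENNReal.ofReal (1 / 2) < 1 := by
          rw [ENNReal.ofReal_lt_one]; norm_num
      _ ≤ μ (⋂ i ∈ T, C i) := h𝒯 T hT
      _ ≤ μ (interior (⋂ i ∈ T, C i) ∪ frontier (⋂ i ∈ T, C i)) :=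
          measure_mono (subset_closure.trans (closure_eq_interior_union_frontier _).subset)
      _ ≤ μ (interior (⋂ i ∈ T, C i)) + μ (frontier (⋂ i ∈ T, C i)) := measure_union_le _ _
      _ = μ (interior (⋂ i ∈ T, C i)) := by rw [hconv.addHaar_frontier μ, add_zero]
  choose! L hLsub hLc hLμ using hL
  let X : ι → Set E := fun i => ⋃ T ∈ ({T ∈ 𝒯 | i ∈ T} : Finset (Finset ι)), L T
  have hXc : ∀ i, IsCompact (X i) := fun i => Finset.isCompact_biUnion _ fun T hT =>
    hLc T (Finset.mem_filter.1 hT).1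
  have hsub : ∀ i, closure (convexHull ℝ (X i)) ⊆ interior (C i) := fun i => by
    refine (hXc i).closure_convexHull_subset isOpen_interior (hC i).interior ?_
    refine Set.iUnion₂_subset fun T hT => ?_
    obtain ⟨hT, hiT⟩ := Finset.mem_filter.1 hT
    exact (hLsub T hT).trans (interior_mono (Set.biInter_subset_of_mem hiT))
  refine ⟨fun i => closure (convexHull ℝ (X i)), fun i => ⟨(hsub i).trans interior_subset,
    (convex_convexHull ℝ _).closure, ?_⟩, fun T hT => ?_⟩
  · exact Metric.isCompact_of_isClosed_isBounded isClosed_closure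
      (isBounded_convexHull.2 (hXc i).isBounded).closure
  · refine (hLμ T hT).le.trans (measure_mono (Set.subset_iInter₂ fun i hi => ?_))
    refine Set.Subset.trans ?_ ((subset_convexHull ℝ _).trans subset_closure)
    exact Set.subset_biUnion_of_mem (u := L) (Finset.mem_filter.2 ⟨hT, hi⟩)

/-- Among three convex sets of reals with a common point, one contains the intersection of the
others. -/
theorem exists_biInter_erase_subset {ι : Type*} [DecidableEq ι] (T : Finset ι) (hT : 2 < T.card)
    (C : ι → Set ℝ) (hC : ∀ i ∈ T, Convex ℝ (C i)) (hne : (⋂ i ∈ T, C i).Nonempty) :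
    ∃ i ∈ T, ⋂ j ∈ T.erase i, C j ⊆ C i := by
  by_contra! hcon
  obtain ⟨z, hz⟩ := hne
  have hz' := Set.mem_iInter₂.1 hz
  have : ∀ i ∈ T, ∃ p, (∀ j ∈ T, j ≠ i → p ∈ C j) ∧ p ∉ C i := by
    intro i hi
    obtain ⟨p, hp, hpi⟩ := Set.not_subset.1 (hcon i hi)
    exact ⟨p, fun j hj hji => Set.mem_iInter₂.1 hp j (Finset.mem_erase.2 ⟨hji, hj⟩), hpi⟩
  obtain ⟨i₀, hi₀⟩ : T.Nonempty := Finset.card_pos.1 (by omega)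
  choose! p hp hpi using this
  obtain ⟨i, hi, j, hj, hij, h⟩ := Finset.exists_ne_map_eq_of_card_lt_of_maps_to
    (f := fun i => decide (z < p i)) (s := T) (t := Finset.univ) (by simpa using hT)
    (fun _ _ => Finset.mem_coe.2 (Finset.mem_univ _))
  have key : ∀ i ∈ T, ∀ j ∈ T, i ≠ j → (z < p i ↔ z < p j) → |p i - z| ≤ |p j - z| → False := by
    intro i hi j hj hij h hle
    refine hpi i hi ?_
    by_cases hzi : z < p i
    · have hzj := h.1 hzi
      rw [abs_of_pos (sub_pos.2 hzi), abs_of_pos (sub_pos.2 hzj)] at hle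
      exact (hC i hi).ordConnected.out (hz' i hi) (hp j hj i hi hij) ⟨hzi.le, by linarith⟩
    · have hzj := mt h.2 hzi
      rw [abs_of_nonpos (by linarith), abs_of_nonpos (by linarith)] at hle
      exact (hC i hi).ordConnected.out (hp j hj i hi hij) (hz' i hi) ⟨by linarith, by linarith⟩
  have h' : z < p i ↔ z < p j := by simpa using h
  rcases le_total |p i - z| |p j - z| with hle | hle
  · exact key i hi j hj hij h' hle
  · exact key j hj i hi hij.symm h'.symm hle

/-- The line case of the quantitative fractional Helly theorem, without loss of volume. -/
theorem fractional_helly_volume_one {α : ℝ} (hα : 0 < α) {n : ℕ} (hn : 4 ≤ n)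
    (C : Fin n → Set (EuclideanSpace ℝ (Fin 1))) (hC : ∀ i, Convex ℝ (C i))
    (𝒯 : Finset (Finset (Fin n)))
    (h𝒯 : ∀ T, T ∈ 𝒯 ↔ T.card = 4 ∧ 1 ≤ volume (⋂ i ∈ T, C i))
    (hcard : α * (n.choose 4 : ℝ) ≤ (𝒯.card : ℝ)) :
    ∃ C' : Finset (Fin n), α / 16 * n ≤ (C'.card : ℝ) ∧ 1 ≤ volume (⋂ i ∈ C', C i) := by
  obtain ⟨S, I, hI, hR⟩ := exists_common_erase (k := 3) hn hα.le 𝒯 (fun T hT => ((h𝒯 T).1 hT).1)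
    hcard (fun S i => 1 ≤ volume (⋂ j ∈ S, C j) ∧ ⋂ j ∈ S, C j ⊆ C i) (by
      intro T hT
      obtain ⟨hT4, hvol⟩ := (h𝒯 T).1 hT
      let e : EuclideanSpace ℝ (Fin 1) ≃ₗ[ℝ] ℝ :=
        LinearEquiv.ofFinrankEq _ _ (by simp)
      obtain ⟨z, hz⟩ : (⋂ i ∈ T, C i).Nonempty :=
        nonempty_of_measure_ne_zero (μ := volume) (one_pos.trans_le hvol).ne'
      obtain ⟨i, hi, hsub⟩ := exists_biInter_erase_subset T (by omega)
        (fun i => e.symm ⁻¹' C i) (fun i _ => (hC i).linear_preimage e.symm.toLinearMap)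
        ⟨e z, by simpa using hz⟩
      refine ⟨i, hi, hvol.trans (measure_mono ?_), fun p hp => ?_⟩
      · exact Set.biInter_subset_biInter_left (Finset.erase_subset i T)
      · have := @hsub (e p) (by simpa using hp)
        simpa using this)
  refine ⟨I, by norm_num at hI; exact hI, ?_⟩
  have hne : I.Nonempty := by
    rw [← Finset.card_pos, ← Nat.cast_pos (α := ℝ)]
    have : (0 : ℝ) < n := by exact_mod_cast (by omega : 0 < n)
    exact lt_of_lt_of_le (by positivity) hI
  obtain ⟨i, hi⟩ := hne
  exact (hR i hi).1.trans (measure_mono (Set.subset_iInter₂ fun j hj => (hR j hj).2))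

/-- The quantitative fractional Helly theorem with explicit polynomial ratio. -/
theorem fractional_helly_volume_of_pos {d : ℕ} (hd : 0 < d) {α : ℝ} (hα : 0 < α) {n : ℕ}
    (hn : 3 * d + 1 ≤ n) (C : Fin n → Set (EuclideanSpace ℝ (Fin d)))
    (hC : ∀ i, Convex ℝ (C i)) (𝒯 : Finset (Finset (Fin n)))
    (h𝒯 : ∀ T, T ∈ 𝒯 ↔ T.card = 3 * d + 1 ∧ 1 ≤ volume (⋂ i ∈ T, C i))
    (hcard : α * (n.choose (3 * d + 1) : ℝ) ≤ (𝒯.card : ℝ)) :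
    ∃ C' : Finset (Fin n),
      (1 / (6 * (d : ℝ) ^ 3)) ^ d * (α / (3 * d + 1) ^ 2) * n ≤ (C'.card : ℝ) ∧
        ENNReal.ofReal ((1 / (6 * (d : ℝ) ^ 3)) ^ d * (1 / 2)) ≤ volume (⋂ i ∈ C', C i) := by
  classical
  have : Nonempty (Fin d) := ⟨⟨0, hd⟩⟩
  have hd1 : (1 : ℝ) ≤ d := by exact_mod_cast hd
  have hfin : Module.finrank ℝ (EuclideanSpace ℝ (Fin d)) = d := by simp
  obtain ⟨D, hD, hDvol⟩ := exists_compact_convex_subsets volume C hC 𝒯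
    fun T hT => ((h𝒯 T).1 hT).2
  have hhalf : (0 : ENNReal) < ENNReal.ofReal (1 / 2) := ENNReal.ofReal_pos.2 (by norm_num)
  set l : ℝ := 1 / (3 * (d : ℝ) ^ 3) with hl
  have hl0 : 0 < l := by positivity
  have hl1 : l ≤ 1 := by
    rw [hl, div_le_one (by positivity)]
    nlinarith [one_le_pow₀ (n := 3) hd1]
  have hl2 : l / 2 = 1 / (6 * (d : ℝ) ^ 3) := by rw [hl]; ring
  obtain ⟨S, I, hI, hR⟩ := exists_common_erase (k := 3 * d) hn hα.le 𝒯
    (fun T hT => ((h𝒯 T).1 hT).1) hcard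
    (fun S i => S.Nonempty ∧ ENNReal.ofReal (1 / 2) ≤ volume (⋂ j ∈ S, D j) ∧
      ∃ c ∈ ⋂ j ∈ S, D j, ∀ p ∈ ⋂ j ∈ S, D j, c + l • (p - c) ∈ D i) (by
      intro T hT
      have hTc := ((h𝒯 T).1 hT).1
      obtain ⟨i₀, hi₀⟩ : T.Nonempty := Finset.card_pos.1 (by omega)
      set K := ⋂ i ∈ T, D i with hK
      have hKvol : 0 < volume K := hhalf.trans_le (hDvol T hT)
      have hKc : Convex ℝ K := convex_iInter₂ fun i _ => (hD i).2.1
      have hKcomp : IsCompact K := (hD i₀).2.2.of_isClosed_subset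
        (isClosed_biInter fun i _ => (hD i).2.2.isClosed) (Set.biInter_subset_of_mem hi₀)
      have hKinf : K.Infinite := fun hf => hKvol.ne' (hf.measure_zero _)
      obtain ⟨c, hcK, hsym⟩ := hKc.exists_center hKcomp hKinf (by rw [hfin]; exact hd)
      rw [hfin] at hsym
      have hint : (interior K).Nonempty := by
        rw [Set.nonempty_iff_ne_empty]
        intro h
        have h1 := hKc.addHaar_frontier volume
        rw [frontier, h, Set.sdiff_empty, hKcomp.isClosed.closure_eq] at h1
        exact hKvol.ne' h1
      have hcint : c ∈ interior K := by
        obtain ⟨z, hz⟩ := hint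
        have h1 := hKc.combo_interior_self_mem_interior hz (hsym z (interior_subset hz))
          (a := 1 / ((d : ℝ) + 1)) (b := d / ((d : ℝ) + 1)) (by positivity) (by positivity)
          (by field_simp; ring)
        convert h1 using 1
        match_scalars <;> field_simp <;> ring
      obtain ⟨i, hi, hsub⟩ := exists_homothety_subset hfin hd T (by omega) D
        (fun i _ => (hD i).2.1) (fun i _ => (hD i).2.2) c hcint hsym
      have hmono : K ⊆ ⋂ j ∈ T.erase i, D j :=
        Set.biInter_subset_biInter_left (Finset.erase_subset i T)
      refine ⟨i, hi, ?_, (hDvol T hT).trans (measure_mono hmono), c, hmono hcK, fun p hp =>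
        Set.mem_iInter₂.1 (hsub p hp) i hi⟩
      rw [← Finset.card_pos, Finset.card_erase_of_mem hi]
      omega)
  have hn0 : (0 : ℝ) < n := by exact_mod_cast (by omega : 0 < n)
  have hIpos : 0 < I.card := by
    rw [← Nat.cast_pos (α := ℝ)]
    exact lt_of_lt_of_le (by positivity) hI
  obtain ⟨i₁, hi₁⟩ := Finset.card_pos.1 hIpos
  obtain ⟨⟨j₀, hj₀⟩, hPvol, -⟩ := hR i₁ hi₁
  have hex : ∀ i ∈ I, ∃ c ∈ ⋂ j ∈ S, D j, ∀ p ∈ ⋂ j ∈ S, D j, c + l • (p - c) ∈ D i :=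
    fun i hi => (hR i hi).2.2
  choose! c hcP hc using hex
  obtain ⟨J, z, hJI, hJ, hz⟩ := exists_common_translate volume
    (convex_iInter₂ fun i _ => (hD i).2.1)
    ((hD j₀).2.2.of_isClosed_subset (isClosed_biInter fun i _ => (hD i).2.2.isClosed)
      (Set.biInter_subset_of_mem hj₀)) (hhalf.trans_le hPvol).ne' I c hcP hl0 hl1
  rw [hfin, hl2] at hJ
  refine ⟨J, ?_, ?_⟩
  · refine le_trans ?_ hJ
    rw [mul_assoc]
    gcongr
    push_cast at hI
    exact hI
  · calc ENNReal.ofReal ((1 / (6 * (d : ℝ) ^ 3)) ^ d * (1 / 2))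
        ≤ ENNReal.ofReal ((l / 2) ^ d) * volume (⋂ j ∈ S, D j) := by
          rw [ENNReal.ofReal_mul (by positivity), hl2]
          gcongr
      _ = volume ((fun p => z + p) '' ((fun p => (l / 2) • p) '' ⋂ j ∈ S, D j)) := by
          have h := Measure.addHaar_smul volume (l / 2) (⋂ j ∈ S, D j)
          rw [hfin, abs_of_nonneg (by positivity)] at h
          rw [Set.image_add_left, measure_preimage_add, ← h]
          rfl
      _ ≤ volume (⋂ i ∈ J, C i) := by
          refine measure_mono (Set.subset_iInter₂ fun i hi => ?_)
          rintro _ ⟨_, ⟨p, hp, rfl⟩, rfl⟩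
          obtain ⟨q, hq, hpq⟩ := hz i hi p hp
          refine (hD i).1 ?_
          dsimp only
          rw [hpq]
          exact hc i (hJI hi) q hq

/-- Quantitative Fractional Helly Theorem (volume version). -/
theorem quantitative_fractional_helly_volume :
    ∃ c : ℝ, 0 < c ∧
      ∀ d : ℕ, 1 ≤ d →
        ∀ α : ℝ, α ∈ Set.Ioo (0 : ℝ) 1 →
          ∃ β : ℝ, β ∈ Set.Ioo (0 : ℝ) 1 ∧
            ∀ n : ℕ, 3 * d + 1 ≤ n →
              ∀ C : Fin n → Set (EuclideanSpace ℝ (Fin d)),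
                (∀ i, Convex ℝ (C i)) →
                α * (n.choose (3 * d + 1) : ℝ) ≤
                  ({S : Finset (Fin n) | S.card = 3 * d + 1 ∧
                      1 ≤ volume (⋂ i ∈ S, C i)}.ncard : ℝ) →
                ∃ C' : Finset (Fin n), β * (n : ℝ) ≤ (C'.card : ℝ) ∧
                  ENNReal.ofReal ((d : ℝ) ^ (-(c * (d : ℝ) ^ 2))) ≤
                    volume (⋂ i ∈ C', C i) := by
  classical
  refine ⟨7, by norm_num, fun d hd α hα => ?_⟩
  have hd1 : (1 : ℝ) ≤ d := by exact_mod_cast hd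
  rcases hd.eq_or_lt with rfl | hd2
  · refine ⟨α / 16, ⟨by linarith [hα.1], by linarith [hα.2]⟩, fun n hn C hC hcard => ?_⟩
    rw [Set.ncard_eq_toFinset_card'] at hcard
    simpa using fractional_helly_volume_one hα.1 hn C hC _ (fun T => by simp) hcard
  · refine ⟨(1 / (6 * (d : ℝ) ^ 3)) ^ d * (α / (3 * d + 1) ^ 2), ⟨?_, ?_⟩,
      fun n hn C hC hcard => ?_⟩
    · have := hα.1
      positivity
    · have h1 : (1 / (6 * (d : ℝ) ^ 3)) ^ d ≤ 1 := by
        refine pow_le_one₀ (by positivity) ?_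
        rw [div_le_one (by positivity)]
        nlinarith [one_le_pow₀ (n := 3) hd1]
      have h2 : α / (3 * (d : ℝ) + 1) ^ 2 < 1 := by
        rw [div_lt_one (by positivity)]
        nlinarith [hα.2]
      have h3 : 0 ≤ α / (3 * (d : ℝ) + 1) ^ 2 := div_nonneg hα.1.le (by positivity)
      nlinarith
    · rw [Set.ncard_eq_toFinset_card'] at hcard
      obtain ⟨C', hC'card, hC'vol⟩ :=
        fractional_helly_volume_of_pos hd hα.1 hn C hC _ (fun T => by simp) hcard
      refine ⟨C', hC'card, le_trans (ENNReal.ofReal_le_ofReal ?_) hC'vol⟩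
      have hd2' : (2 : ℝ) ≤ d := by exact_mod_cast hd2
      have hd0 : (0 : ℝ) < d := by linarith
      calc (d : ℝ) ^ (-(7 * (d : ℝ) ^ 2)) ≤ (d : ℝ) ^ (-((6 * d + 1 : ℕ) : ℝ)) := by
            refine Real.rpow_le_rpow_of_exponent_le hd1 (neg_le_neg ?_)
            push_cast
            nlinarith
        _ = (1 / ((d : ℝ) ^ 3 * (d : ℝ) ^ 3)) ^ d * (1 / d) := by
            rw [Real.rpow_neg hd0.le, Real.rpow_natCast, pow_succ, pow_mul, ← pow_add, one_div_pow,
              mul_inv, one_div, one_div]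
        _ ≤ (1 / (6 * (d : ℝ) ^ 3)) ^ d * (1 / 2) := by
            have : (6 : ℝ) ≤ (d : ℝ) ^ 3 := by
              calc (6 : ℝ) ≤ 2 ^ 3 := by norm_num
                _ ≤ _ := by gcongr
            gcongr
end

section
/- Quantitative Fractional Helly Theorem (ellipsoid version): There is a universal constant c > 0 such that for every dimension d ≥ 1 and every α ∈ (0,1) there exists β ∈ (0,1) with the following property. Let 𝒞 be a finite family of n ≥ 3d+1 convex sets in ℝ^d such that among all subfamilies of 𝒞 of size 3d+1, at least α · C(n, 3d+1) subfamilies have the property that the intersection of their 3d+1 members contains an ellipsoid of volume one. Then there is a subfamily 𝒞′ ⊆ 𝒞 of size at least β·n such that the intersection of all members of 𝒞′ contains an ellipsoid of volume at least c^(d²) · d^(−5d²/2 + d). -/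
open MeasureTheory

/-- An ellipsoid is the image of the closed Euclidean unit ball under an
invertible affine transformation. -/
def IsEllipsoid {d : ℕ} (E : Set (EuclideanSpace ℝ (Fin d))) : Prop :=
  ∃ L : EuclideanSpace ℝ (Fin d) ≃ᵃ[ℝ] EuclideanSpace ℝ (Fin d),
    E = L '' Metric.closedBall 0 1

universe u v

/-- Among more than `2 * k` nonzero vectors in dimension `k`, some nonzero vector lies in each of the
cones spanned by all but one of them. -/
theorem exists_ne_zero_mem_span_image_diff (k : ℕ) {V : Type u} [AddCommGroup V] [Module ℝ V]
    [FiniteDimensional ℝ V] (hk : Module.finrank ℝ V ≤ k) {ι : Type v}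
    (s : Finset ι) (x : ι → V) (hx : ∀ i ∈ s, x i ≠ 0) (hs : 2 * k + 1 ≤ s.card) :
    ∃ y : V, y ≠ 0 ∧ ∀ j ∈ s, y ∈ Submodule.span NNReal (x '' (↑s \ {j})) := by
  classical
  induction k using Nat.strong_induction_on generalizing V s with
  | _ k ih =>
  have hmono : ∀ {a b : Set ι}, a ⊆ b →
      Submodule.span NNReal (x '' a) ≤ Submodule.span NNReal (x '' b) :=
    fun h => Submodule.span_mono (Set.image_mono h)
  have hmem : ∀ {a : Set ι} {i : ι}, i ∈ a → x i ∈ Submodule.span NNReal (x '' a) :=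
    fun h => Submodule.subset_span (Set.mem_image_of_mem x h)
  have hdep : ¬ LinearIndepOn ℝ x (s : Set ι) := by
    intro h
    have h1 := LinearIndependent.fintype_card_le_finrank h
    simp at h1
    omega
  obtain ⟨I, hIs, hI⟩ := exists_minimal_le_of_wellFoundedLT
    (fun t : Finset ι => ¬ LinearIndepOn ℝ x (t : Set ι)) s hdep
  have hIs : I ⊆ s := hIs
  have herase : ∀ i ∈ I, LinearIndepOn ℝ x (I.erase i : Set ι) := by
    intro i hi
    by_contra h
    have := hI.2 (by simpa using h) (Finset.erase_subset i I)
    exact Finset.notMem_erase i I (this hi)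
  obtain ⟨a, ha0, i₀, hi₀, hai₀⟩ : ∃ a : ι → ℝ, ∑ i ∈ I, a i • x i = 0 ∧ ∃ i ∈ I, a i ≠ 0 := by
    have := hI.1
    simp only [linearIndepOn_finset_iff, not_forall] at this
    obtain ⟨a, h1, i, h2, h3⟩ := this
    exact ⟨a, h1, i, h2, h3⟩
  have hane : ∀ i ∈ I, a i ≠ 0 := by
    intro i hi h0
    have h1 := linearIndepOn_finset_iff.1 (herase i hi) a (by
      rw [← ha0, ← Finset.add_sum_erase I _ hi, h0]; simp)
    by_cases h : i₀ = i
    · exact hai₀ (h ▸ h0)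
    · exact hai₀ (h1 i₀ (Finset.mem_erase.2 ⟨h, hi₀⟩))
  by_cases hmix : (∃ p ∈ I, 0 < a p) ∧ (∃ q ∈ I, a q < 0)
  · obtain ⟨⟨p, hp, hap⟩, ⟨q, hq, haq⟩⟩ := hmix
    have key : ∑ i ∈ I, max (a i) 0 • x i = ∑ i ∈ I, max (-a i) 0 • x i := by
      rw [← sub_eq_zero, ← Finset.sum_sub_distrib, ← ha0]
      refine Finset.sum_congr rfl fun i _ => ?_
      rw [← sub_smul, max_zero_sub_eq_self]
    have hspan : ∀ (b : ι → ℝ), (∀ i, 0 ≤ b i) → ∀ j, b j = 0 →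
        ∑ i ∈ I, b i • x i ∈ Submodule.span NNReal (x '' (↑s \ {j})) := by
      intro b hb j hj
      refine Submodule.sum_mem _ fun i hi => ?_
      by_cases h : i = j
      · subst h; simp [hj]
      · exact Submodule.smul_mem _ (⟨b i, hb i⟩ : NNReal) (hmem ⟨hIs hi, h⟩)
    refine ⟨∑ i ∈ I, max (a i) 0 • x i, ?_, fun j hj => ?_⟩
    · intro h0
      have h1 := linearIndepOn_finset_iff.1 (herase q hq) (fun i => max (a i) 0) (by
        rw [← h0, ← Finset.add_sum_erase I _ hq, max_eq_right haq.le]; simp)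
      have h2 := h1 p (Finset.mem_erase.2 ⟨by rintro rfl; linarith, hp⟩)
      rw [max_eq_left hap.le] at h2
      linarith
    · rcases le_total (a j) 0 with h | h
      · exact hspan _ (fun i => le_max_right _ _) j (max_eq_right h)
      · rw [key]
        exact hspan _ (fun i => le_max_right _ _) j (max_eq_right (by linarith))
  obtain ⟨b, hb0, hb⟩ : ∃ b : ι → ℝ, ∑ i ∈ I, b i • x i = 0 ∧ ∀ i ∈ I, 0 < b i := by
    by_cases h : ∃ p ∈ I, 0 < a p
    · refine ⟨a, ha0, fun i hi => lt_of_le_of_ne ?_ (hane i hi).symm⟩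
      by_contra h'
      exact hmix ⟨h, i, hi, not_le.1 h'⟩
    · refine ⟨fun i => - a i, by simp [ha0], fun i hi => ?_⟩
      have h1 : ¬ 0 < a i := fun h' => h ⟨i, hi, h'⟩
      have h2 := lt_of_le_of_ne (not_lt.1 h1) (hane i hi)
      linarith
  set L := Submodule.span ℝ (x '' (I : Set ι)) with hL
  have hneg : ∀ i ∈ I, - x i ∈ Submodule.span NNReal (x '' (I : Set ι)) := by
    intro i hi
    have h1 : - x i = (b i)⁻¹ • ∑ j ∈ I.erase i, b j • x j := by
      rw [← Finset.add_sum_erase I _ hi] at hb0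
      rw [← neg_eq_of_add_eq_zero_right hb0, smul_neg, smul_smul, inv_mul_cancel₀ (hb i hi).ne',
        one_smul]
    rw [h1]
    refine Submodule.smul_mem _ (⟨(b i)⁻¹, (inv_pos.2 (hb i hi)).le⟩ : NNReal)
      (Submodule.sum_mem _ fun j hj => ?_)
    have hj := Finset.mem_of_mem_erase hj
    exact Submodule.smul_mem _ (⟨b j, (hb j hj).le⟩ : NNReal) (hmem hj)
  have hLcone : ∀ z ∈ L, z ∈ Submodule.span NNReal (x '' (I : Set ι)) := by
    intro z hz
    refine Submodule.closure_induction (R := ℝ) ?_ ?_ ?_ hz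
    · exact Submodule.zero_mem _
    · exact fun _ _ _ _ h1 h2 => Submodule.add_mem _ h1 h2
    · rintro r _ ⟨i, hi, rfl⟩
      rcases le_total 0 r with h | h
      · exact Submodule.smul_mem _ (⟨r, h⟩ : NNReal) (hmem hi)
      · rw [← neg_smul_neg]
        exact Submodule.smul_mem _ (⟨-r, by linarith⟩ : NNReal) (hneg i hi)
  by_cases hm : ∃ m ∈ s \ I, x m ∈ L
  · obtain ⟨m, hm, hmL⟩ := hm
    rw [Finset.mem_sdiff] at hm
    refine ⟨x m, hx m hm.1, fun j hj => ?_⟩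
    by_cases h : j = m
    · subst h
      have hIj : (I : Set ι) ⊆ ↑s \ {j} :=
        fun i hi => ⟨hIs hi, fun h' => hm.2 ((show i = j from h') ▸ hi)⟩
      exact hmono hIj (hLcone _ hmL)
    · exact hmem ⟨hm.1, fun h' => h (Eq.symm h')⟩
  push Not at hm
  have hcard1 : I.card - 1 ≤ Module.finrank ℝ L := by
    have h1 := LinearIndependent.fintype_card_le_finrank
      (b := fun i : (I.erase i₀ : Finset ι) => (⟨x i, Submodule.subset_span
        (Set.mem_image_of_mem x (Finset.mem_of_mem_erase i.2))⟩ : L))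
      (LinearIndependent.of_comp L.subtype (herase i₀ hi₀))
    simpa [Finset.card_erase_of_mem hi₀] using h1
  have hcard2 : 1 ≤ Module.finrank ℝ L := by
    rw [Nat.one_le_iff_ne_zero]
    intro h
    rw [Submodule.finrank_eq_zero] at h
    have : x i₀ ∈ L := Submodule.subset_span ⟨i₀, hi₀, rfl⟩
    rw [h] at this
    exact hx i₀ (hIs hi₀) (by simpa using this)
  have hq := Submodule.finrank_quotient_add_finrank L
  have hcs := Finset.card_sdiff_add_card_eq_card hIs
  obtain ⟨yq, hyq0, hyq⟩ := ih (k - Module.finrank ℝ L) (by omega) (V := V ⧸ L) (by omega)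
    (s \ I) (fun i => L.mkQ (x i))
    (fun i hi => by simpa using hm i hi) (by omega)
  have hlift : ∀ j ∈ s \ I, ∃ y ∈ Submodule.span NNReal (x '' (↑(s \ I) \ {j})), L.mkQ y = yq := by
    intro j hj
    have h1 := hyq j hj
    have h2 : (fun i => L.mkQ (x i)) '' (↑(s \ I) \ {j}) =
      (L.mkQ.restrictScalars NNReal) '' (x '' (↑(s \ I) \ {j})) := by
      rw [Set.image_image]; rfl
    rw [h2, ← Submodule.map_span] at h1
    exact h1
  obtain ⟨j₀, hj₀⟩ : (s \ I).Nonempty := Finset.card_pos.1 (by omega)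
  obtain ⟨y, hy, hyy⟩ := hlift j₀ hj₀
  refine ⟨y, ?_, fun j hj => ?_⟩
  · rintro rfl
    exact hyq0 (by rw [← hyy]; simp)
  · by_cases hjI : j ∈ I
    · refine hmono ?_ hy
      intro i hi
      have := hi.1
      simp only [Finset.coe_sdiff, Set.mem_sdiff, Finset.mem_coe] at this
      exact ⟨this.1, fun h => this.2 ((show i = j from h) ▸ hjI)⟩
    · obtain ⟨z, hz, hzz⟩ := hlift j (Finset.mem_sdiff.2 ⟨hj, hjI⟩)
      have h1 : y - z ∈ L := by
        rw [← Submodule.ker_mkQ L, LinearMap.mem_ker, map_sub, hyy, hzz, sub_self]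
      have h2 := hLcone _ h1
      rw [← add_sub_cancel z y]
      refine Submodule.add_mem _ (hmono ?_ hz) (hmono ?_ h2)
      · intro i hi
        have := hi.1
        simp only [Finset.coe_sdiff, Set.mem_sdiff, Finset.mem_coe] at this
        exact ⟨this.1, hi.2⟩
      · exact fun i hi => ⟨hIs hi, fun h => hjI ((show i = j from h) ▸ hi)⟩

open Filter Topology in
/-- Any convex sets that contain the unit ball and, for each `j`, all points `R' • x i` with `i ≠ j`,
have a common point of norm larger than `R`, provided `R'` is large enough. -/
theorem exists_large_mem_of_unit_vectors {V : Type u} [NormedAddCommGroup V] [NormedSpace ℝ V]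
    [FiniteDimensional ℝ V] {ι : Type v} [Fintype ι]
    (hι : 2 * Module.finrank ℝ V + 1 ≤ Fintype.card ι) (R : ℝ) :
    ∃ R' : ℝ, 0 < R' ∧ ∀ x : ι → V, (∀ i, ‖x i‖ = 1) → ∃ y : V, R < ‖y‖ ∧
      ∀ (j : ι) (C : Set V), Convex ℝ C → Metric.closedBall 0 1 ⊆ C →
        (∀ i, i ≠ j → R' • x i ∈ C) → y ∈ C := by
  classical
  have hK : IsCompact (Set.univ.pi fun _ : ι => Metric.sphere (0 : V) 1) :=
    isCompact_univ_pi fun _ => isCompact_sphere 0 1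
  have main := hK.eventually_forall_of_forall_eventually (x₀ := (0 : ℝ))
    (P := fun ε x => 0 < ε → ∃ y : V, R < ‖y‖ ∧
      ∀ (j : ι) (C : Set V), Convex ℝ C → Metric.closedBall 0 1 ⊆ C →
        (∀ i, i ≠ j → ε⁻¹ • x i ∈ C) → y ∈ C) ?_
  · obtain ⟨ε, hε, hpos⟩ := ((main.filter_mono nhdsWithin_le_nhds).and
      (self_mem_nhdsWithin (s := Set.Ioi (0 : ℝ)))).exists
    exact ⟨ε⁻¹, inv_pos.2 hpos, fun x hx => hε x (by simpa using hx) hpos⟩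
  intro x hx
  have hx0 : ∀ i ∈ (Finset.univ : Finset ι), x i ≠ 0 := by
    intro i _ h
    have := hx i trivial
    simp [h] at this
  obtain ⟨y₀, hy₀, hy₀mem⟩ := exists_ne_zero_mem_span_image_diff _ le_rfl Finset.univ x hx0 hι
  have hc : 0 < (|R| + 1) / ‖y₀‖ := by positivity
  obtain ⟨y, hyR, hy⟩ : ∃ y : V, R < ‖y‖ ∧
      ∀ j, y ∈ Submodule.span NNReal (x '' (↑(Finset.univ : Finset ι) \ {j})) := by
    refine ⟨((|R| + 1) / ‖y₀‖) • y₀, ?_, fun j =>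
      Submodule.smul_mem _ (⟨_, hc.le⟩ : NNReal) (hy₀mem j (Finset.mem_univ j))⟩
    rw [norm_smul, Real.norm_of_nonneg hc.le, div_mul_cancel₀ _ (norm_ne_zero_iff.2 hy₀)]
    linarith [le_abs_self R]
  have hlocal : ∀ j, ∀ᶠ z : ℝ × (ι → V) in 𝓝 (0, x), 0 < z.1 →
      ∀ (C : Set V), Convex ℝ C → Metric.closedBall 0 1 ⊆ C →
        (∀ i, i ≠ j → z.1⁻¹ • z.2 i ∈ C) → y ∈ C := by
    intro j
    obtain ⟨t, ht, c, hc⟩ := (Submodule.mem_span_image_iff_exists_fun NNReal).1 (hy j)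
    have h1 : ∀ᶠ z : ℝ × (ι → V) in 𝓝 (0, x), z.1 * ∑ i, (c i : ℝ) < 1 / 2 := by
      have hcont : Continuous fun z : ℝ × (ι → V) => z.1 * ∑ i, (c i : ℝ) := by fun_prop
      exact (hcont.tendsto (0, x)).eventually_lt_const (by norm_num)
    have h2 : ∀ᶠ z : ℝ × (ι → V) in 𝓝 (0, x), ‖∑ i, (c i : ℝ) • (x i - z.2 i)‖ < 1 / 2 := by
      have hcont : Continuous fun z : ℝ × (ι → V) => ‖∑ i, (c i : ℝ) • (x i - z.2 i)‖ := by
        fun_prop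
      exact (hcont.tendsto (0, x)).eventually_lt_const (by simp)
    filter_upwards [h1, h2] with z hz1 hz2 hz C hC hB hxC
    set r := z.1 * ∑ i, (c i : ℝ) with hr
    set e := ∑ i, (c i : ℝ) • (x i - z.2 i) with he
    have hsum := hC.sum_mem (t := (Finset.univ : Finset (Option t)))
      (w := fun o => o.elim (1 - r) (fun i => z.1 * c i))
      (z := fun o => o.elim ((1 - r)⁻¹ • e) (fun i => z.1⁻¹ • z.2 i)) ?_ ?_ ?_
    · rw [Fintype.sum_option] at hsum
      simp only [Option.elim] at hsum
      convert hsum using 1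
      rw [smul_inv_smul₀ (by linarith), he, ← Finset.sum_add_distrib, ← hc]
      refine Finset.sum_congr rfl fun i _ => ?_
      rw [smul_smul, mul_right_comm, mul_inv_cancel₀ hz.ne', one_mul, ← smul_add, sub_add_cancel]
      rfl
    · rintro (_ | i) _
      · simp only [Option.elim]; linarith
      · simp only [Option.elim]; positivity
    · rw [Fintype.sum_option]
      simp only [Option.elim]
      rw [← Finset.mul_sum]; ring
    · rintro (_ | i) _
      · refine hB ?_
        simp only [Option.elim, mem_closedBall_zero_iff]
        rw [norm_smul, norm_inv, Real.norm_of_nonneg (by linarith), inv_mul_le_iff₀ (by linarith)]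
        linarith
      · exact hxC i fun h => (ht i.2).2 h
  filter_upwards [Filter.eventually_all.2 hlocal] with z hz hpos
  exact ⟨y, hyR, fun j C hC hB hxC => hz j hpos C hC hB hxC⟩

/-- If the intersection of more than `2 * dim V` convex sets is comparable to an ellipsoid, then so is
the intersection of all but a suitable one of them. -/
theorem exists_iInter_ne_subset_image_closedBall {V : Type u} [NormedAddCommGroup V]
    [NormedSpace ℝ V] [FiniteDimensional ℝ V] {ι : Type v} [Fintype ι]
    (hι : 2 * Module.finrank ℝ V + 1 ≤ Fintype.card ι) (R : ℝ) :
    ∃ R' : ℝ, 0 < R' ∧ ∀ (C : ι → Set V) (A : V ≃ᵃ[ℝ] V), (∀ i, Convex ℝ (C i)) →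
      (∀ i, A '' Metric.closedBall 0 1 ⊆ C i) → (⋂ i, C i) ⊆ A '' Metric.closedBall 0 R →
      ∃ j, (⋂ i, ⋂ (_ : i ≠ j), C i) ⊆ A '' Metric.closedBall 0 R' := by
  obtain ⟨R', hR', h⟩ := exists_large_mem_of_unit_vectors hι R
  refine ⟨R', hR', fun C A hC hA hR => ?_⟩
  by_contra! hcon
  have hpt : ∀ j, ∃ z : V, R' < ‖z‖ ∧ ∀ i, i ≠ j → A z ∈ C i := by
    intro j
    obtain ⟨p, hp, hpA⟩ := Set.not_subset.1 (hcon j)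
    refine ⟨A.symm p, ?_, fun i hi => ?_⟩
    · by_contra hle
      exact hpA ⟨A.symm p, by simpa using hle, by simp⟩
    · simpa using Set.mem_iInter₂.1 hp i hi
  choose z hz hzC using hpt
  have hz0 : ∀ i, 0 < ‖z i‖ := fun i => hR'.trans (hz i)
  have hB : ∀ i, Metric.closedBall 0 1 ⊆ A ⁻¹' C i := fun i => Set.image_subset_iff.1 (hA i)
  have hCA : ∀ i, Convex ℝ (A ⁻¹' C i) := fun i => (hC i).affine_preimage A.toAffineMap
  obtain ⟨y, hyR, hy⟩ := h (fun i => ‖z i‖⁻¹ • z i) fun i => by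
    rw [norm_smul, norm_inv, norm_norm, inv_mul_cancel₀ (hz0 i).ne']
  have hyC : A y ∈ ⋂ i, C i := by
    refine Set.mem_iInter.2 fun j => hy j (A ⁻¹' C j) (hCA j) (hB j) fun i hij => ?_
    rw [smul_smul]
    refine (hCA j).smul_mem_of_zero_mem (hB j (by simp)) (hzC i j hij.symm)
      ⟨mul_nonneg hR'.le (inv_nonneg.2 (hz0 i).le), ?_⟩
    rw [mul_inv_le_iff₀ (hz0 i), one_mul]
    exact (hz i).le
  obtain ⟨w, hw, hwy⟩ := hR hyC
  rw [A.injective hwy] at hw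
  exact absurd (mem_closedBall_zero_iff.1 hw) (not_le.2 hyR)

/-- Pairwise comparable ellipsoids split into boundedly many classes, such that half of each ellipsoid
lies in every other ellipsoid of its class. -/
theorem exists_coloring_of_comparable_image_closedBall (V : Type u) [NormedAddCommGroup V]
    [NormedSpace ℝ V] [FiniteDimensional ℝ V] {ρ : ℝ} (hρ : 0 < ρ) :
    ∃ N : ℕ, ∀ (ι : Type v) (A : ι → V ≃ᵃ[ℝ] V),
      (∀ s t, A s '' Metric.closedBall 0 1 ⊆ A t '' Metric.closedBall 0 ρ) →
      ∃ col : ι → Fin N, ∀ s t, col s = col t →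
        A s '' Metric.closedBall 0 (1 / 2) ⊆ A t '' Metric.closedBall 0 1 := by
  have hTB : TotallyBounded (Metric.closedBall (0 : (V →L[ℝ] V) × V) (2 * ρ)) :=
    (isCompact_closedBall _ _).totallyBounded
  have hδ : 0 < 1 / (16 * ρ) := by positivity
  obtain ⟨T, hT, hcover⟩ := Metric.totallyBounded_iff.1 hTB (1 / (16 * ρ)) hδ
  have := hT.fintype
  let eqv := Fintype.equivFin T
  refine ⟨Fintype.card T, fun ι A hA => ?_⟩
  rcases isEmpty_or_nonempty ι with hι | ⟨⟨s₀⟩⟩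
  · exact ⟨isEmptyElim, isEmptyElim⟩
  have hlin : ∀ (G : V ≃ᵃ[ℝ] V) (u v : V), G u - G v = G.linear (u - v) := fun G u v => by
    simpa using (G.toAffineMap.linearMap_vsub u v).symm
  have hbound : ∀ G : V ≃ᵃ[ℝ] V, (∀ u, ‖u‖ ≤ 1 → ‖G u‖ ≤ ρ) →
      ‖LinearMap.toContinuousLinearMap (G.linear : V →ₗ[ℝ] V)‖ ≤ 2 * ρ := by
    intro G hG
    refine ContinuousLinearMap.opNorm_le_of_unit_norm (by positivity) fun u hu => ?_
    have h1 : (G.linear : V →ₗ[ℝ] V) u = G u - G 0 := by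
      rw [hlin]; simp
    rw [LinearMap.coe_toContinuousLinearMap', h1]
    have h2 := hG u hu.le
    have h3 := hG 0 (by simp)
    linarith [norm_sub_le (G u) (G 0)]
  have hcomp : ∀ s t (u : V), ‖u‖ ≤ 1 → ‖(A t).symm (A s u)‖ ≤ ρ := by
    intro s t u hu
    obtain ⟨w, hw, hwu⟩ := hA s t ⟨u, by simpa using hu, rfl⟩
    rw [← hwu, AffineEquiv.symm_apply_apply]
    simpa using hw
  let G : ι → V ≃ᵃ[ℝ] V := fun s => (A s).trans (A s₀).symm
  let Φ : ι → (V →L[ℝ] V) × V := fun s =>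
    (LinearMap.toContinuousLinearMap ((G s).linear : V →ₗ[ℝ] V), G s 0)
  have hΦ : ∀ s, Φ s ∈ Metric.closedBall (0 : (V →L[ℝ] V) × V) (2 * ρ) := by
    intro s
    rw [mem_closedBall_zero_iff, Prod.norm_def]
    refine max_le (hbound _ fun u hu => hcomp s s₀ u hu) ?_
    exact (hcomp s s₀ 0 (by simp)).trans (by linarith)
  have hcell : ∀ s, ∃ c : T, dist (Φ s) c < 1 / (16 * ρ) := by
    intro s
    obtain ⟨c, hc, hs⟩ := Set.mem_iUnion₂.1 (hcover (hΦ s))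
    exact ⟨⟨c, hc⟩, hs⟩
  choose cell hcell using hcell
  refine ⟨fun s => eqv (cell s), fun s t hst => ?_⟩
  have hst : cell s = cell t := eqv.injective hst
  have hdist : ‖Φ s - Φ t‖ ≤ 1 / (8 * ρ) := by
    rw [← dist_eq_norm]
    have h1 := hcell s
    have h2 := hcell t
    rw [← hst, dist_comm] at h2
    have h3 := dist_triangle (Φ s) (cell s) (Φ t)
    have h4 : 1 / (8 * ρ) = 1 / (16 * ρ) + 1 / (16 * ρ) := by field_simp; norm_num
    linarith
  have happly : ∀ s u, G s u = (Φ s).1 u + (Φ s).2 := by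
    intro s u
    have := hlin (G s) u 0
    rw [sub_zero] at this
    rw [← sub_eq_iff_eq_add]
    exact this
  rintro _ ⟨u, hu, rfl⟩
  have hu : ‖u‖ ≤ 1 / 2 := by simpa using hu
  refine ⟨(A t).symm (A s u), ?_, by simp⟩
  rw [mem_closedBall_zero_iff]
  have hdiff : ‖G s u - G t u‖ ≤ 1 / (4 * ρ) := by
    have h1 : G s u - G t u = (Φ s - Φ t).1 u + (Φ s - Φ t).2 := by
      rw [happly, happly, Prod.fst_sub, Prod.snd_sub, sub_apply]; abel
    rw [h1]
    have h2 := ((Φ s - Φ t).1.le_opNorm u)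
    have h3 := (norm_fst_le (Φ s - Φ t)).trans hdist
    have h4 := (norm_snd_le (Φ s - Φ t)).trans hdist
    have h5 : ‖(Φ s - Φ t).1‖ * ‖u‖ ≤ 1 / (8 * ρ) * 1 := by
      gcongr
      linarith
    have h6 : 1 / (4 * ρ) = 1 / (8 * ρ) + 1 / (8 * ρ) := by field_simp; norm_num
    linarith [norm_add_le ((Φ s - Φ t).1 u) (Φ s - Φ t).2]
  have hdecomp : (A t).symm (A s u) = (G t).symm.linear (G s u - G t u) + u := by
    rw [← hlin, AffineEquiv.symm_apply_apply, sub_add_cancel]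
    apply (G t).injective
    rw [AffineEquiv.apply_symm_apply]
    simp [G]
  have h7 : ‖(G t).symm.linear (G s u - G t u)‖ ≤ 2 * ρ * (1 / (4 * ρ)) := by
    have := (LinearMap.toContinuousLinearMap ((G t).symm.linear : V →ₗ[ℝ] V)).le_of_opNorm_le
      (hbound (G t).symm fun v hv => hcomp s₀ t v hv) (G s u - G t u)
    refine this.trans ?_
    gcongr
  have h8 : 2 * ρ * (1 / (4 * ρ)) = 1 / 2 := by field_simp; norm_num
  rw [hdecomp]
  linarith [norm_add_le ((G t).symm.linear (G s u - G t u)) u]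

open scoped Pointwise in
theorem volume_image_affineEquiv {d : ℕ}
    (A : EuclideanSpace ℝ (Fin d) ≃ᵃ[ℝ] EuclideanSpace ℝ (Fin d))
    (s : Set (EuclideanSpace ℝ (Fin d))) :
    volume (A '' s) =
      ENNReal.ofReal |LinearMap.det (A.linear : EuclideanSpace ℝ (Fin d) →ₗ[ℝ] _)| * volume s := by
  have h : A '' s = A 0 +ᵥ (A.linear : EuclideanSpace ℝ (Fin d) →ₗ[ℝ] _) '' s := by
    rw [← Set.image_vadd, Set.image_image]
    refine Set.image_congr fun u _ => ?_
    have := A.map_vadd 0 u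
    simpa [add_comm] using this
  rw [h, measure_vadd, Measure.addHaar_image_linearMap]

/-- The convex hull of the unit ball and a far away point contains an ellipsoid of at least twice the
volume of the ball. -/
theorem exists_affineEquiv_image_closedBall_subset_of_large_norm {d : ℕ}
    {z : EuclideanSpace ℝ (Fin d)} (hz : 2 ^ (d + 2) < ‖z‖) :
    ∃ Q : EuclideanSpace ℝ (Fin d) ≃ᵃ[ℝ] EuclideanSpace ℝ (Fin d),
      2 * volume (Metric.closedBall (0 : EuclideanSpace ℝ (Fin d)) 1) ≤
        volume (Q '' Metric.closedBall 0 1) ∧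
      ∀ K : Set (EuclideanSpace ℝ (Fin d)), Convex ℝ K → Metric.closedBall 0 1 ⊆ K → z ∈ K →
        Q '' Metric.closedBall 0 1 ⊆ K := by
  have hz0 : 0 < ‖z‖ := lt_trans (by positivity) hz
  have hzz : inner ℝ z z = ‖z‖ ^ 2 := real_inner_self_eq_norm_sq z
  let f : Module.Dual ℝ (EuclideanSpace ℝ (Fin d)) := (‖z‖⁻¹ • innerSL ℝ z).toLinearMap
  have hf : ∀ u, f u = ‖z‖⁻¹ * inner ℝ z u := fun u => rfl
  let q : EuclideanSpace ℝ (Fin d) →ₗ[ℝ] EuclideanSpace ℝ (Fin d) :=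
    (1 / 2 : ℝ) • LinearMap.transvection f ((1 / 2 - ‖z‖⁻¹) • z)
  have hdet : LinearMap.det q = (1 / 2) ^ d * (‖z‖ / 2) := by
    rw [LinearMap.det_smul, LinearMap.transvection.det, finrank_euclideanSpace_fin, hf,
      inner_smul_right, hzz]
    congr 1
    field_simp
    ring
  have hdet2 : 2 < LinearMap.det q := by
    rw [hdet, one_div, inv_pow, ← div_eq_inv_mul, lt_div_iff₀ (by positivity)]
    rw [pow_add] at hz
    linarith
  let Q : EuclideanSpace ℝ (Fin d) ≃ᵃ[ℝ] EuclideanSpace ℝ (Fin d) :=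
    (q.equivOfDetNeZero (by linarith)).toAffineEquiv.trans
      (AffineEquiv.constVAdd ℝ (EuclideanSpace ℝ (Fin d)) ((1 / 4 : ℝ) • z))
  have hQlin : (Q.linear : EuclideanSpace ℝ (Fin d) →ₗ[ℝ] _) = q := by
    ext u : 1
    rfl
  refine ⟨Q, ?_, fun K hK hB hzK => ?_⟩
  · rw [volume_image_affineEquiv, hQlin]
    gcongr
    have h2 : (2 : ENNReal) = ENNReal.ofReal 2 := by simp
    exact h2.trans_le (ENNReal.ofReal_le_ofReal (hdet2.le.trans (le_abs_self _)))
  · rintro _ ⟨u, hu, rfl⟩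
    rw [mem_closedBall_zero_iff] at hu
    have hfu : |f u| ≤ 1 := by
      rw [hf, abs_mul, abs_inv, abs_norm, inv_mul_le_iff₀ hz0]
      exact (abs_real_inner_le_norm z u).trans (by gcongr)
    obtain ⟨hfu1, hfu2⟩ := abs_le.1 hfu
    set τ := (f u + 1) / 4 with hτ
    set p := u - (f u * ‖z‖⁻¹) • z with hp
    have hpn : ‖p‖ ≤ 1 := by
      refine le_trans ?_ hu
      refine le_of_sq_le_sq ?_ (norm_nonneg u)
      rw [hp, norm_sub_sq_real, inner_smul_right, norm_smul, real_inner_comm, mul_pow,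
        Real.norm_eq_abs, sq_abs, hf]
      have : 0 ≤ (inner ℝ z u) ^ 2 * ‖z‖⁻¹ ^ 2 := by positivity
      field_simp
      field_simp at this
      nlinarith
    have hQu : Q u = τ • z + (1 - τ) • ((1 - τ)⁻¹ • ((1 / 2 : ℝ) • p)) := by
      have h1 : Q u = (1 / 4 : ℝ) • z + (1 / 2 : ℝ) • (u + f u • ((1 / 2 - ‖z‖⁻¹) • z)) := rfl
      rw [h1, smul_inv_smul₀ (by linarith), hp, hτ]
      module
    rw [hQu]
    refine hK hzK (hB ?_) (by linarith) (by linarith) (by ring)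
    rw [mem_closedBall_zero_iff, norm_smul, norm_smul, norm_inv,
      Real.norm_of_nonneg (by linarith : 0 ≤ 1 - τ), inv_mul_le_iff₀ (by linarith)]
    norm_num
    linarith

/-- A bounded convex set that contains an ellipsoid of volume one lies between an ellipsoid of volume
at least one half and its dilate by `2 ^ (d + 2)`. -/
theorem exists_almost_max_ellipsoid {d : ℕ} {K : Set (EuclideanSpace ℝ (Fin d))}
    (hK : Convex ℝ K) (hb : Bornology.IsBounded K)
    (hE : ∃ E, IsEllipsoid E ∧ volume E = 1 ∧ E ⊆ K) :
    ∃ A : EuclideanSpace ℝ (Fin d) ≃ᵃ[ℝ] EuclideanSpace ℝ (Fin d),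
      A '' Metric.closedBall 0 1 ⊆ K ∧ K ⊆ A '' Metric.closedBall 0 (2 ^ (d + 2)) ∧
      1 / 2 ≤ volume (A '' Metric.closedBall 0 1) := by
  obtain ⟨E, ⟨A₀, hA₀⟩, hE1, hEK⟩ := hE
  set M := ⨆ A : {A : EuclideanSpace ℝ (Fin d) ≃ᵃ[ℝ] EuclideanSpace ℝ (Fin d) //
    A '' Metric.closedBall 0 1 ⊆ K}, volume (A.1 '' Metric.closedBall 0 1) with hM
  have hle : ∀ A : EuclideanSpace ℝ (Fin d) ≃ᵃ[ℝ] EuclideanSpace ℝ (Fin d),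
      A '' Metric.closedBall 0 1 ⊆ K → volume (A '' Metric.closedBall 0 1) ≤ M :=
    fun A hA => le_iSup (fun A : {A : EuclideanSpace ℝ (Fin d) ≃ᵃ[ℝ] EuclideanSpace ℝ (Fin d) //
      A '' Metric.closedBall 0 1 ⊆ K} => volume (A.1 '' Metric.closedBall 0 1)) ⟨A, hA⟩
  have hM1 : 1 ≤ M := by
    rw [← hE1, hA₀]
    exact hle A₀ (hA₀ ▸ hEK)
  have hMtop : M ≠ ⊤ :=
    ((iSup_le fun A => measure_mono A.2).trans_lt hb.measure_lt_top).ne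
  obtain ⟨⟨A, hAK⟩, hA⟩ := lt_iSup_iff.1
    (ENNReal.half_lt_self (zero_lt_one.trans_le hM1).ne' hMtop)
  refine ⟨A, hAK, fun x hx => ?_, (ENNReal.div_le_div_right hM1 2).trans hA.le⟩
  refine ⟨A.symm x, ?_, by simp⟩
  rw [mem_closedBall_zero_iff]
  by_contra! hlarge
  obtain ⟨Q, hQvol, hQ⟩ := exists_affineEquiv_image_closedBall_subset_of_large_norm hlarge
  have hsub := hQ (A ⁻¹' K) (hK.affine_preimage A.toAffineMap) (Set.image_subset_iff.1 hAK)
    (by simpa using hx)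
  have himg : (Q.trans A) '' Metric.closedBall 0 1 = A '' (Q '' Metric.closedBall 0 1) := by
    rw [Set.image_image]; rfl
  have h1 := hle (Q.trans A) (by rw [himg]; exact Set.image_subset_iff.2 hsub)
  rw [himg, volume_image_affineEquiv A] at h1
  refine absurd h1 (not_le.2 ?_)
  refine lt_of_lt_of_le ?_ (mul_le_mul_right hQvol _)
  rw [mul_left_comm, ← volume_image_affineEquiv A]
  rwa [ENNReal.div_lt_iff (by simp) (by simp), mul_comm] at hA

theorem isEllipsoid_image_half_closedBall {d : ℕ}
    (A : EuclideanSpace ℝ (Fin d) ≃ᵃ[ℝ] EuclideanSpace ℝ (Fin d)) :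
    IsEllipsoid (A '' Metric.closedBall 0 (1 / 2)) := by
  refine ⟨(LinearEquiv.smulOfNeZero ℝ (EuclideanSpace ℝ (Fin d)) (1 / 2 : ℝ)
    (by norm_num)).toAffineEquiv.trans A, ?_⟩
  have h := smul_unitClosedBall_of_nonneg (E := EuclideanSpace ℝ (Fin d))
    (r := (1 / 2 : ℝ)) (by norm_num)
  rw [← h, ← Set.image_smul, Set.image_image]
  rfl

theorem le_volume_image_half_closedBall {d : ℕ}
    (A : EuclideanSpace ℝ (Fin d) ≃ᵃ[ℝ] EuclideanSpace ℝ (Fin d))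
    (hA : 1 / 2 ≤ volume (A '' Metric.closedBall 0 1)) :
    ENNReal.ofReal ((1 / 2) ^ (d + 1)) ≤ volume (A '' Metric.closedBall 0 (1 / 2)) := by
  rw [volume_image_affineEquiv, Measure.addHaar_closedBall' _ _ (by norm_num), mul_left_comm,
    ← volume_image_affineEquiv, finrank_euclideanSpace_fin, pow_succ,
    ENNReal.ofReal_mul (by positivity)]
  gcongr
  refine le_trans (le_of_eq ?_) hA
  rw [one_div, ENNReal.ofReal_inv_of_pos two_pos]
  simp

theorem pow_sq_mul_rpow_le_half_pow {d : ℕ} (hd : 1 ≤ d) :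
    (1 / 4 : ℝ) ^ (d ^ 2) * (d : ℝ) ^ (-(5 * (d : ℝ) ^ 2 / 2) + (d : ℝ)) ≤
      (1 / 2) ^ (d + 1) := by
  have hd' : (1 : ℝ) ≤ d := by exact_mod_cast hd
  have h1 : (d : ℝ) ^ (-(5 * (d : ℝ) ^ 2 / 2) + (d : ℝ)) ≤ 1 :=
    Real.rpow_le_one_of_one_le_of_nonpos hd' (by nlinarith)
  have h2 : (1 / 4 : ℝ) ^ (d ^ 2) ≤ (1 / 2) ^ (d + 1) := by
    rw [show (1 / 4 : ℝ) = (1 / 2) ^ 2 by norm_num, ← pow_mul]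
    exact pow_le_pow_of_le_one (by norm_num) (by norm_num) (by nlinarith)
  calc _ ≤ (1 / 4 : ℝ) ^ (d ^ 2) * 1 := by gcongr
    _ ≤ _ := by rwa [mul_one]

/-- Dropping a suitable member from a subfamily leaves an intersection comparable to an ellipsoid
inside the intersection of the whole subfamily. -/
theorem exists_erase_iInter_subset_image_closedBall {d : ℕ} (hd : 1 ≤ d) :
    ∃ R : ℝ, 0 < R ∧ ∀ (ι : Type v) [DecidableEq ι] (D : ι → Set (EuclideanSpace ℝ (Fin d)))
      (S : Finset ι), (∀ i, Convex ℝ (D i)) → (∀ i, Bornology.IsBounded (D i)) →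
      S.card = 3 * d + 1 → (∃ E, IsEllipsoid E ∧ volume E = 1 ∧ E ⊆ ⋂ i ∈ S, D i) →
      ∃ A : EuclideanSpace ℝ (Fin d) ≃ᵃ[ℝ] EuclideanSpace ℝ (Fin d), ∃ j ∈ S,
        A '' Metric.closedBall 0 1 ⊆ ⋂ i ∈ S, D i ∧
        ⋂ i ∈ S.erase j, D i ⊆ A '' Metric.closedBall 0 R ∧
        1 / 2 ≤ volume (A '' Metric.closedBall 0 1) := by
  obtain ⟨R, hR, h⟩ := exists_iInter_ne_subset_image_closedBall
    (V := EuclideanSpace ℝ (Fin d)) (ι := Fin (3 * d + 1)) (by simp; omega) (2 ^ (d + 2))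
  refine ⟨R, hR, fun ι _ D S hconv hbdd hS hE => ?_⟩
  let e := (S.equivFinOfCardEq hS).symm
  obtain ⟨A, hAK, hKA, hA⟩ := exists_almost_max_ellipsoid
    (convex_iInter₂ fun i (_ : i ∈ S) => hconv i)
    ((hbdd (e 0)).subset (Set.biInter_subset_of_mem (e 0).2)) hE
  obtain ⟨j, hj⟩ := h (fun k => D (e k)) A (fun k => hconv _)
    (fun k => hAK.trans (Set.biInter_subset_of_mem (e k).2))
    (Set.Subset.trans (fun p hp => Set.mem_iInter₂.2 fun i hi => by
      simpa using Set.mem_iInter.1 hp (e.symm ⟨i, hi⟩)) hKA)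
  refine ⟨A, e j, (e j).2, hAK, Set.Subset.trans (fun p hp => ?_) hj, hA⟩
  refine Set.mem_iInter₂.2 fun k hk => Set.mem_iInter₂.1 hp _ (Finset.mem_erase.2 ⟨?_, (e k).2⟩)
  exact fun h => hk (e.injective (Subtype.ext h))

theorem mul_choose_le_mul_choose_succ {α : ℝ} (hα : 0 ≤ α) (k n N : ℕ) (hn : k + 1 ≤ n) :
    (n.choose k * N : ℝ) * (α / ((N + 1) * (k + 1) ^ 2) * n) ≤ α * n.choose (k + 1) := by
  obtain ⟨m, rfl⟩ := Nat.exists_eq_add_of_le hn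
  have h1 : ((k + 1 + m).choose (k + 1) * (k + 1) : ℝ) = (k + 1 + m).choose k * (m + 1) := by
    have := Nat.choose_succ_right_eq (k + 1 + m) k
    rw [show k + 1 + m - k = m + 1 by omega] at this
    exact_mod_cast this
  have h2 : ((k + 1 + m).choose (k + 1) : ℝ) = (k + 1 + m).choose k * (m + 1) / (k + 1) := by
    rw [← h1]; field_simp
  rw [h2]
  have h3 : ((k + 1 + m : ℕ) : ℝ) ≤ (k + 1) * (m + 1) := by
    push_cast
    nlinarith [mul_nonneg (Nat.cast_nonneg (α := ℝ) k) (Nat.cast_nonneg (α := ℝ) m)]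
  calc _ ≤ ((k + 1 + m).choose k * (N + 1) : ℝ) *
        (α / ((N + 1) * (k + 1) ^ 2) * ((k + 1) * (m + 1))) := by
        gcongr
        linarith
    _ = _ := by field_simp

/-- Quantitative Fractional Helly Theorem (ellipsoid version). -/
theorem quantitative_fractional_helly_ellipsoid :
    ∃ c : ℝ, 0 < c ∧
      ∀ d : ℕ, 1 ≤ d →
        ∀ α : ℝ, α ∈ Set.Ioo (0 : ℝ) 1 →
          ∃ β : ℝ, β ∈ Set.Ioo (0 : ℝ) 1 ∧
            ∀ n : ℕ, 3 * d + 1 ≤ n →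
              ∀ C : Fin n → Set (EuclideanSpace ℝ (Fin d)),
                (∀ i, Convex ℝ (C i)) →
                α * (n.choose (3 * d + 1) : ℝ) ≤
                  ({S : Finset (Fin n) | S.card = 3 * d + 1 ∧
                      ∃ E, IsEllipsoid E ∧ volume E = 1 ∧
                        E ⊆ ⋂ i ∈ S, C i}.ncard : ℝ) →
                ∃ C' : Finset (Fin n), β * (n : ℝ) ≤ (C'.card : ℝ) ∧
                  ∃ E, IsEllipsoid E ∧
                    ENNReal.ofReal
                        (c ^ (d ^ 2) *
                          (d : ℝ) ^ (-(5 * (d : ℝ) ^ 2 / 2) + (d : ℝ))) ≤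
                      volume E ∧
                    E ⊆ ⋂ i ∈ C', C i := by
  classical
  refine ⟨1 / 4, by norm_num, fun d hd α hα => ?_⟩
  obtain ⟨R, hR, hshape⟩ := exists_erase_iInter_subset_image_closedBall hd
  obtain ⟨N, hN⟩ := exists_coloring_of_comparable_image_closedBall (EuclideanSpace ℝ (Fin d)) hR
  refine ⟨α / ((N + 1) * ((3 * d : ℕ) + 1) ^ 2), ⟨div_pos hα.1 (by positivity), ?_⟩,
    fun n hn C hC hcount => ?_⟩
  · rw [div_lt_one (by positivity)]
    refine hα.2.trans_le ?_
    exact_mod_cast Nat.one_le_iff_ne_zero.2 (by positivity)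
  set good := {S : Finset (Fin n) | S.card = 3 * d + 1 ∧
    ∃ E, IsEllipsoid E ∧ volume E = 1 ∧ E ⊆ ⋂ i ∈ S, C i}
  choose E hEell hEvol hEsub using fun S : good => S.2.2
  have hEbdd : Bornology.IsBounded (⋃ S, E S) := by
    refine Bornology.isBounded_iUnion.2 fun S => ?_
    obtain ⟨L, hL⟩ := hEell S
    rw [hL]
    exact ((isCompact_closedBall _ _).image
      L.toAffineMap.continuous_of_finiteDimensional).isBounded
  obtain ⟨r, hr⟩ := hEbdd.subset_closedBall 0
  have hex := fun S : good => hshape (Fin n) (fun i => C i ∩ Metric.closedBall 0 r) S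
    (fun i => (hC i).inter (convex_closedBall 0 r))
    (fun i => Metric.isBounded_closedBall.subset Set.inter_subset_right) S.2.1
    ⟨E S, hEell S, hEvol S, Set.subset_iInter₂ fun i hi => Set.subset_inter
      ((hEsub S).trans (Set.biInter_subset_of_mem hi)) ((Set.subset_iUnion E S).trans hr)⟩
  choose A j hjS hAS hSA hvol using hex
  have hfib := fun T : Finset (Fin n) =>
    hN {S : good // S.1.erase (j S) = T} (fun S => A S) (by
      rintro ⟨S, hS⟩ ⟨S', hS'⟩
      refine (hAS S).trans (Set.Subset.trans ?_ (hSA S'))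
      rw [hS', ← hS]
      exact Set.biInter_mono (Finset.erase_subset _ _) fun _ _ => subset_rfl)
  choose col hcol using hfib
  let F : good → Finset (Fin n) × Fin N := fun S => (S.1.erase (j S), col _ ⟨S, rfl⟩)
  have hF : ∀ S S', F S = F S' →
      A S '' Metric.closedBall 0 (1 / 2) ⊆ A S' '' Metric.closedBall 0 1 := by
    intro S S' h
    have hcast : ∀ T (hT : S.1.erase (j S) = T), col _ ⟨S, rfl⟩ = col T ⟨S, hT⟩ := by
      rintro _ rfl
      rfl
    have hT : S.1.erase (j S) = S'.1.erase (j S') := congrArg Prod.fst h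
    exact hcol _ ⟨S, hT⟩ ⟨S', rfl⟩ ((hcast _ hT).symm.trans (congrArg Prod.snd h))
  have hcard : (good.ncard : ℝ) = (Finset.univ : Finset good).card := by
    rw [← Nat.card_coe_set_eq, Nat.card_eq_fintype_card, Finset.card_univ]
  have hα0 : 0 < α * n.choose (3 * d + 1) :=
    mul_pos hα.1 (by exact_mod_cast Nat.choose_pos hn)
  have hFmem : ∀ S ∈ (Finset.univ : Finset good),
      F S ∈ Finset.powersetCard (3 * d) Finset.univ ×ˢ (Finset.univ : Finset (Fin N)) := by
    intro S _
    simp [F, Finset.card_erase_of_mem (hjS S), S.2.1]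
  obtain ⟨S₁, hS₁⟩ : (Finset.univ : Finset good).Nonempty := by
    rw [← Finset.card_pos]
    exact_mod_cast hα0.trans_le (hcount.trans_eq hcard)
  obtain ⟨y, -, hy⟩ := Finset.exists_le_card_fiber_of_nsmul_le_card_of_maps_to hFmem
    ⟨_, hFmem S₁ hS₁⟩ (b := α / ((N + 1) * ((3 * d : ℕ) + 1) ^ 2) * n) (by
      rw [← hcard, nsmul_eq_mul]
      refine le_trans ?_ hcount
      simpa using mul_choose_le_mul_choose_succ hα.1.le (3 * d) n N hn)
  set fib := {S ∈ (Finset.univ : Finset good) | F S = y}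
  obtain ⟨S₀, hS₀⟩ : fib.Nonempty := by
    rw [← Finset.card_pos]
    have hn0 : (0 : ℝ) < n := by exact_mod_cast (by omega : 0 < n)
    exact_mod_cast (mul_pos (div_pos hα.1 (by positivity)) hn0).trans_le hy
  refine ⟨fib.biUnion fun S => S.1, hy.trans ?_, A S₀ '' Metric.closedBall 0 (1 / 2),
    isEllipsoid_image_half_closedBall _, ?_, ?_⟩
  · refine Nat.cast_le.2 (Finset.card_le_card_of_injOn j
      (fun S hS => Finset.mem_biUnion.2 ⟨S, hS, hjS S⟩) fun S hS S' hS' h => Subtype.ext ?_)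
    have hT : S.1.erase (j S) = S'.1.erase (j S') := congrArg Prod.fst
      ((Finset.mem_filter.1 hS).2.trans (Finset.mem_filter.1 hS').2.symm)
    rw [← Finset.insert_erase (hjS S), hT, h, Finset.insert_erase (hjS S')]
  · exact (ENNReal.ofReal_le_ofReal (pow_sq_mul_rpow_le_half_pow hd)).trans
      (le_volume_image_half_closedBall _ (hvol S₀))
  · refine Set.subset_iInter₂ fun i hi => ?_
    obtain ⟨S, hS, hiS⟩ := Finset.mem_biUnion.1 hi
    refine (hF S₀ S ((Finset.mem_filter.1 hS₀).2.trans (Finset.mem_filter.1 hS).2.symm)).trans ?_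
    exact (hAS S).trans ((Set.biInter_subset_of_mem hiS).trans Set.inter_subset_left)
end

section
/- Quantitative Fractional Helly for large subfamilies: For every dimension d ≥ 1 and every α ∈ (0,1) the following holds with β = 2α/(d(d+3)). Let 𝒞 be a finite family of n ≥ d(d+3)/2 convex bodies in ℝ^d such that among all subfamilies of 𝒞 of size d(d+3)/2, at least α · C(n, d(d+3)/2) subfamilies have the property that the intersection of their d(d+3)/2 members contains an ellipsoid of volume one. Then there is a subfamily 𝒞′ ⊆ 𝒞 of size at least β·n such that the intersection of all members of 𝒞′ contains an ellipsoid of volume one. -/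
open MeasureTheory

/-- A sub-convex combination, based at a point `e` of a convex set, of displacements towards points
of the set stays in the set. -/
lemma Convex.add_sum_smul_sub_mem {V ι : Type*} [AddCommGroup V] [Module ℝ V] [Fintype ι]
    {X : Set V} (hX : Convex ℝ X) {e : V} (he : e ∈ X) {a : ι → ℝ} {y : ι → V}
    (ha : ∀ i, 0 ≤ a i) (ha1 : ∑ i, a i ≤ 1) (hy : ∀ i, a i ≠ 0 → y i ∈ X) :
    e + ∑ i, a i • (y i - e) ∈ X := by
  classical
  have h := hX.sum_mem (t := Finset.univ) (w := fun o : Option ι => o.elim (1 - ∑ i, a i) a)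
    (z := fun o : Option ι => o.elim e fun i => if a i = 0 then e else y i)
    (by rintro (_ | i) - <;> simp [ha, ha1]) (by simp [Fintype.sum_option])
    (by
      rintro (_ | i) -
      · simpa using he
      · by_cases hi : a i = 0
        · simpa [hi] using he
        · simpa [hi] using hy i hi)
  have hite : ∀ i, a i • (if a i = 0 then e else y i) = a i • y i := fun i => by
    by_cases hi : a i = 0 <;> simp [hi]
  simp only [Fintype.sum_option, Option.elim, hite] at h
  convert h using 1
  simp only [smul_sub, Finset.sum_sub_distrib, sub_smul, one_smul, Finset.sum_smul]
  abel

section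

variable {V : Type*} [NormedAddCommGroup V] [InnerProductSpace ℝ V]

/-- Among more than `finrank ℝ V` vectors having negative inner product with `e`, there are two
nonnegative combinations with disjoint supports representing the same vector, the first of which
avoids a prescribed index. -/
lemma exists_disjoint_nonneg_combinations_of_inner_neg [FiniteDimensional ℝ V] {κ : Type*}
    [Fintype κ] (hκ : Module.finrank ℝ V < Fintype.card κ) (o : κ) {e : V} {u : κ → V}
    (hu : ∀ i, inner ℝ e (u i) < 0) :
    ∃ a b : κ → ℝ, (∀ i, 0 ≤ a i) ∧ (∀ i, 0 ≤ b i) ∧ (∀ i, a i = 0 ∨ b i = 0) ∧ a o = 0 ∧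
      ∑ i, a i ≤ 1 ∧ ∑ i, b i ≤ 1 ∧ ∑ i, a i • u i = ∑ i, b i • u i ∧
      inner ℝ e (∑ i, a i • u i) < 0 := by
  have hdep : ¬ LinearIndependent ℝ u := fun h => h.fintype_card_le_finrank.not_gt hκ
  obtain ⟨g, hg, hgo, hg0⟩ : ∃ g : κ → ℝ, ∑ i, g i • u i = 0 ∧ g o ≤ 0 ∧ ∃ i, g i ≠ 0 := by
    obtain ⟨g, hg, hg0⟩ := Fintype.not_linearIndependent_iff.1 hdep
    rcases le_total (g o) 0 with h | h
    · exact ⟨g, hg, h, hg0⟩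
    · exact ⟨-g, by simp [hg], by simpa using h, by simpa using hg0⟩
  set A := ∑ i, max (g i) 0
  set B := ∑ i, max (-g i) 0
  have hA : 0 ≤ A := Finset.sum_nonneg fun _ _ => le_max_right _ _
  have hB : 0 ≤ B := Finset.sum_nonneg fun _ _ => le_max_right _ _
  set s := (1 + A + B)⁻¹
  have hs : 0 < s := by positivity
  have hs1 : s * (1 + A + B) = 1 := inv_mul_cancel₀ (by positivity)
  have heq : ∑ i, max (g i) 0 • u i = ∑ i, max (-g i) 0 • u i := by
    rw [← sub_eq_zero, ← Finset.sum_sub_distrib, ← hg]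
    refine Finset.sum_congr rfl fun i _ => ?_
    rw [← sub_smul]
    congr 1
    rcases le_total (g i) 0 with h | h <;> simp [h]
  have hterm : ∀ c : ℝ, ∀ i, 0 ≤ c → c * inner ℝ e (u i) ≤ 0 := fun c i hc =>
    mul_nonpos_of_nonneg_of_nonpos hc (hu i).le
  have hneg : inner ℝ e (∑ i, max (g i) 0 • u i) < 0 := by
    obtain ⟨i, hi⟩ := hg0
    rcases lt_or_gt_of_ne hi with h | h
    · rw [heq]
      simp only [inner_sum, inner_smul_right]
      refine Finset.sum_neg' (fun j _ => hterm _ j (le_max_right _ _)) ⟨i, Finset.mem_univ _, ?_⟩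
      exact mul_neg_of_pos_of_neg (lt_max_of_lt_left (by linarith)) (hu i)
    · simp only [inner_sum, inner_smul_right]
      refine Finset.sum_neg' (fun j _ => hterm _ j (le_max_right _ _)) ⟨i, Finset.mem_univ _, ?_⟩
      exact mul_neg_of_pos_of_neg (lt_max_of_lt_left h) (hu i)
  refine ⟨fun i => s * max (g i) 0, fun i => s * max (-g i) 0, fun i => by positivity,
    fun i => by positivity, fun i => ?_, by simp [hgo], ?_, ?_, ?_, ?_⟩
  · rcases le_total (g i) 0 with h | h <;> simp [h]
  · rw [← Finset.mul_sum]; change s * A ≤ 1; nlinarith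
  · rw [← Finset.mul_sum]; change s * B ≤ 1; nlinarith
  · simp only [mul_smul, ← Finset.smul_sum, heq]
  · simp only [mul_smul, ← Finset.smul_sum, inner_smul_right]
    exact mul_neg_of_pos_of_neg hs hneg

/-- A nonempty closed convex set contains a point of least norm. -/
lemma exists_forall_inner_sub_nonneg [CompleteSpace V] {K : Set V} (hne : K.Nonempty)
    (hcl : IsClosed K) (hK : Convex ℝ K) : ∃ e ∈ K, ∀ x ∈ K, 0 ≤ inner ℝ e (x - e) := by
  obtain ⟨e, he, hmin⟩ := exists_norm_eq_iInf_of_complete_convex hne hcl.isComplete hK 0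
  refine ⟨e, he, fun x hx => ?_⟩
  have := (norm_eq_iInf_iff_real_inner_le_zero hK he).1 hmin x hx
  simpa using this

/-- Let `Q` and `P i` be convex sets such that from each point of `Q` one may decrease the norm to
first order without leaving those `P i` that contain the point. If `m T` is the least-norm point of
`Q ∩ ⋂ i ∈ T, P i` for all `T` for which this set is nonempty, then for `T = S` with
`finrank ℝ V ≤ #S`, one of the sets `P i` is redundant. -/
lemma exists_leastNorm_erase_mem [FiniteDimensional ℝ V] {ι : Type*} [DecidableEq ι]
    {P : ι → Set V} {Q : Set V} (hP : ∀ i, Convex ℝ (P i)) (hQ : Convex ℝ Q) (z : V → V)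
    (hzP : ∀ i, ∀ x ∈ P i, z x ∈ P i) (hz : ∀ x ∈ Q, inner ℝ x (z x - x) < 0)
    (m : Finset ι → V)
    (hm : ∀ T : Finset ι, (∃ x ∈ Q, ∀ i ∈ T, x ∈ P i) → (m T ∈ Q ∧ ∀ i ∈ T, m T ∈ P i) ∧
      ∀ x ∈ Q, (∀ i ∈ T, x ∈ P i) → 0 ≤ inner ℝ (m T) (x - m T))
    (S : Finset ι) (hS : Module.finrank ℝ V ≤ S.card) (hne : ∃ x ∈ Q, ∀ i ∈ S, x ∈ P i) :
    ∃ j ∈ S, m (S.erase j) ∈ Q ∧ ∀ i ∈ S, m (S.erase j) ∈ P i := by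
  obtain ⟨⟨heQ, heP⟩, hmin⟩ := hm S hne
  set e := m S
  have herase : ∀ j, (m (S.erase j) ∈ Q ∧ ∀ i ∈ S.erase j, m (S.erase j) ∈ P i) ∧
      ∀ x ∈ Q, (∀ i ∈ S.erase j, x ∈ P i) →
        0 ≤ inner ℝ (m (S.erase j)) (x - m (S.erase j)) := fun j =>
    hm _ ⟨e, heQ, fun i hi => heP i (Finset.mem_of_mem_erase hi)⟩
  by_contra! hcon
  have hnot : ∀ j ∈ S, m (S.erase j) ∉ P j := fun j hj hmem => by
    obtain ⟨i, hi, hiP⟩ := hcon j hj (herase j).1.1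
    rcases eq_or_ne i j with rfl | hij
    · exact hiP hmem
    · exact hiP ((herase j).1.2 i (Finset.mem_erase.2 ⟨hij, hi⟩))
  let y : Option S → V := fun o => o.elim (z e) fun j => m (S.erase j)
  have hu : ∀ o, inner ℝ e (y o - e) < 0 := by
    rintro (_ | ⟨j, hj⟩)
    · exact hz e heQ
    · change inner ℝ e (m (S.erase j) - e) < 0
      have hne' : m (S.erase j) - e ≠ 0 := fun h =>
        hnot j hj (sub_eq_zero.1 h ▸ heP j hj)
      have h1 := (herase j).2 e heQ fun i hi => heP i (Finset.mem_of_mem_erase hi)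
      have h2 : 0 < inner ℝ (m (S.erase j) - e) (m (S.erase j) - e) :=
        real_inner_self_pos.2 hne'
      rw [← neg_sub, inner_neg_right] at h1
      rw [inner_sub_left] at h2
      linarith
  obtain ⟨a, b, ha, hb, hab, ha0, ha1, hb1, heq, hneg⟩ :=
    exists_disjoint_nonneg_combinations_of_inner_neg (κ := Option S) (by simp; omega) none hu
  refine (hmin (e + ∑ o, a o • (y o - e)) ?_ fun j hj => ?_).not_gt (by simpa using hneg)
  · refine hQ.add_sum_smul_sub_mem heQ ha ha1 ?_
    rintro (_ | j) h
    · exact absurd ha0 h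
    · exact (herase j).1.1
  · have hyP : ∀ o, o ≠ some ⟨j, hj⟩ → y o ∈ P j := by
      rintro (_ | i) h
      · exact hzP j e (heP j hj)
      · refine (herase i).1.2 j (Finset.mem_erase.2 ⟨?_, hj⟩)
        rintro rfl
        exact h rfl
    rcases hab (some ⟨j, hj⟩) with h | h
    · exact (hP j).add_sum_smul_sub_mem (heP j hj) ha ha1 fun o ho =>
        hyP o fun h' => ho (h' ▸ h)
    · rw [heq]
      exact (hP j).add_sum_smul_sub_mem (heP j hj) hb hb1 fun o ho =>
        hyP o fun h' => ho (h' ▸ h)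

end

/-- If at least an `α` fraction of the `k`-subsets of `Fin n` is good and each good set `S` contains
a point `j` such that `S.erase j` determines a set `F (S.erase j)` covering `S`, then one of the
sets `F B` with `S.erase j = B` for some good `S` has at least `α * n / k` elements. -/
lemma exists_card_ge_of_erase_determines {n k : ℕ} (hk : 1 ≤ k) (hkn : k ≤ n) {α : ℝ}
    (hα : 0 < α) (hα1 : α ≤ 1) (G : Finset (Finset (Fin n))) (hG : ∀ S ∈ G, S.card = k)
    (hcard : α * (n.choose k : ℝ) ≤ (G.card : ℝ)) (j : Finset (Fin n) → Fin n)
    (hj : ∀ S ∈ G, j S ∈ S) (F : Finset (Fin n) → Finset (Fin n))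
    (hF : ∀ S ∈ G, S ⊆ F (S.erase (j S))) :
    ∃ S ∈ G, α / k * n ≤ ((F (S.erase (j S))).card : ℝ) := by
  obtain ⟨k, rfl⟩ : ∃ l, k = l + 1 := ⟨k - 1, by omega⟩
  by_contra! hlt
  set T := Finset.powersetCard k (Finset.univ : Finset (Fin n))
  have hT : (T.card : ℝ) = n.choose k := by simp [T]
  have hmaps : ∀ S ∈ G, S.erase (j S) ∈ T := fun S hS => by
    simp [T, Finset.mem_powersetCard, Finset.card_erase_of_mem (hj S hS), hG S hS]
  have hfib : ∀ B ∈ T, ((G.filter fun S => S.erase (j S) = B).card : ℝ)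
      < α * (n - k) / (k + 1) := by
    intro B hB
    have hBk : B.card = k := (Finset.mem_powersetCard.1 hB).2
    have hkn' : (k : ℝ) + 1 ≤ n := by exact_mod_cast hkn
    rcases (G.filter fun S => S.erase (j S) = B).eq_empty_or_nonempty with h0 | ⟨S₀, hS₀F⟩
    · rw [h0, Finset.card_empty, Nat.cast_zero]
      have : (0 : ℝ) < n - k := by linarith
      positivity
    obtain ⟨hS₀, rfl⟩ := Finset.mem_filter.1 hS₀F
    set B := S₀.erase (j S₀)
    have hB : B ⊆ F B := (Finset.erase_subset _ _).trans (hF S₀ hS₀)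
    have hinj : (G.filter fun S => S.erase (j S) = B).card ≤ (F B \ B).card := by
      refine Finset.card_le_card_of_injOn j (fun S hS => ?_) fun S hS S' hS' h => ?_
      · obtain ⟨hS, hSB⟩ := Finset.mem_filter.1 hS
        refine Finset.mem_coe.2 (Finset.mem_sdiff.2 ⟨hSB ▸ hF S hS (hj S hS), ?_⟩)
        rw [← hSB]
        simp
      · obtain ⟨hS, hSB⟩ := Finset.mem_filter.1 hS
        obtain ⟨hS', hSB'⟩ := Finset.mem_filter.1 hS'
        rw [← Finset.insert_erase (hj S hS), ← Finset.insert_erase (hj S' hS'), hSB, hSB', h]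
    have hsd := Finset.card_sdiff_add_card_eq_card hB
    rw [hBk] at hsd
    have hle : ((G.filter fun S => S.erase (j S) = B).card : ℝ) + k ≤ (F B).card := by
      exact_mod_cast hsd ▸ Nat.add_le_add_right hinj k
    have := hlt S₀ hS₀
    have hαk : α * (n - k) / (k + 1) = α / ((k + 1 : ℕ) : ℝ) * n - α * (k / (k + 1)) := by
      push_cast
      field_simp
    have h1 : (k : ℝ) / (k + 1) ≤ k :=
      div_le_self (by positivity) (by linarith [k.cast_nonneg (α := ℝ)])
    have h2 : α * ((k : ℝ) / (k + 1)) ≤ 1 * ((k : ℝ) / (k + 1)) := by gcongr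
    rw [hαk]
    linarith
  have hTne : T.Nonempty := Finset.powersetCard_nonempty.2 (by simp; omega)
  have hsum : (G.card : ℝ) < T.card * (α * (n - k) / (k + 1)) := by
    rw [Finset.card_eq_sum_card_fiberwise hmaps]
    push_cast
    rw [← nsmul_eq_mul, ← Finset.sum_const]
    exact Finset.sum_lt_sum_of_nonempty hTne hfib
  have hch : (n.choose (k + 1) : ℝ) * (k + 1) = n.choose k * (n - k) := by
    have := n.choose_succ_right_eq k
    rw [← Nat.cast_sub (by omega)]
    exact_mod_cast this
  refine (hcard.trans_lt hsum).ne ?_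
  rw [hT]
  field_simp
  linear_combination hch

/-- The coordinates of a pair consisting of a point of `ℝ^d` and a lower triangular
`d × d` matrix. -/
abbrev CenterShapeIndex (d : ℕ) : Type := Fin d ⊕ Σ i : Fin d, Fin (i + 1)

/-- Pairs consisting of a center in `ℝ^d` and a lower triangular `d × d` matrix, with the
Euclidean structure given by all their coordinates. -/
abbrev CenterShape (d : ℕ) : Type := EuclideanSpace ℝ (CenterShapeIndex d)

namespace CenterShape

variable {d : ℕ}

lemma finrank_eq : Module.finrank ℝ (CenterShape d) = d * (d + 3) / 2 := by
  have h : ∑ i : Fin d, ((i : ℕ) + 1) = ∑ i ∈ Finset.range (d + 1), i := by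
    rw [Fin.sum_univ_eq_sum_range (fun i => i + 1) d, Finset.sum_range_succ' _ d, add_zero]
  have h2 := Finset.sum_range_id_mul_two (d + 1)
  simp only [finrank_euclideanSpace, Fintype.card_sum, Fintype.card_fin, Fintype.card_sigma, h]
  rw [Nat.add_sub_cancel] at h2
  symm
  apply Nat.div_eq_of_eq_mul_left two_pos
  rw [add_mul, h2]
  ring

/-- The lower triangular matrix of a pair. -/
def shape : CenterShape d →ₗ[ℝ] Matrix (Fin d) (Fin d) ℝ where
  toFun x := Matrix.of fun i j =>
    if h : j ≤ i then x (Sum.inr ⟨i, ⟨j, Nat.lt_succ_of_le h⟩⟩) else 0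
  map_add' x y := by
    ext i j
    by_cases h : j ≤ i <;> simp [h]
  map_smul' r x := by
    ext i j
    by_cases h : j ≤ i <;> simp [h]

/-- The center of a pair. -/
def center : CenterShape d →ₗ[ℝ] EuclideanSpace ℝ (Fin d) where
  toFun x := WithLp.toLp 2 fun i => x (Sum.inl i)
  map_add' x y := by ext i; simp
  map_smul' r x := by ext i; simp

lemma shape_isLowerTriangular (x : CenterShape d) : (shape x).IsLowerTriangular := by
  intro i j hij
  have h : i < j := hij
  simp [shape, h.not_ge]

lemma det_shape (x : CenterShape d) : (shape x).det = ∏ i, shape x i i :=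
  Matrix.det_of_isLowerTriangular _ x.shape_isLowerTriangular

lemma exists_center_shape_eq (c : EuclideanSpace ℝ (Fin d)) {L : Matrix (Fin d) (Fin d) ℝ}
    (hL : L.IsLowerTriangular) : ∃ x : CenterShape d, center x = c ∧ shape x = L := by
  refine ⟨WithLp.toLp 2 (Sum.elim (fun i => c i)
    fun p => L p.1 ⟨p.2, p.2.2.trans_le p.1.2⟩), ?_, ?_⟩
  · ext i
    simp [center]
  · ext i j
    by_cases h : j ≤ i
    · simp [shape, h]
    · simpa [shape, h] using (hL (show i < j from not_le.1 h)).symm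

/-- The affine map with the given center and shape, as a linear function of the pair. -/
def pointAt (b : EuclideanSpace ℝ (Fin d)) : CenterShape d →ₗ[ℝ] EuclideanSpace ℝ (Fin d) :=
  center + (LinearMap.applyₗ b).comp ((Matrix.toLpLin 2 2).toLinearMap.comp shape)

lemma pointAt_apply (b : EuclideanSpace ℝ (Fin d)) (x : CenterShape d) :
    pointAt b x = center x + Matrix.toLpLin 2 2 (shape x) b := rfl

/-- The (possibly degenerate) ellipsoid with the given center and shape. -/
def solid (x : CenterShape d) : Set (EuclideanSpace ℝ (Fin d)) :=
  (fun b => pointAt b x) '' Metric.closedBall 0 1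

lemma solid_eq (x : CenterShape d) :
    x.solid = (fun y => center x + y) '' (Matrix.toLpLin 2 2 (shape x) '' Metric.closedBall 0 1) := by
  simp only [solid, pointAt_apply, Set.image_image]

lemma volume_solid (x : CenterShape d) :
    volume x.solid = ENNReal.ofReal |∏ i, shape x i i| *
      volume (Metric.closedBall (0 : EuclideanSpace ℝ (Fin d)) 1) := by
  rw [solid_eq, Set.image_add_left, measure_preimage_add, Measure.addHaar_image_linearMap,
    LinearMap.det_toLpLin, det_shape]

lemma volume_closedBall_pos : 0 < volume.real (Metric.closedBall (0 : EuclideanSpace ℝ (Fin d)) 1) :=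
  ENNReal.toReal_pos (Metric.measure_closedBall_pos _ _ one_pos).ne' measure_closedBall_lt_top.ne

lemma volume_solid_eq_one_iff (x : CenterShape d) : volume x.solid = 1 ↔
    volume.real (Metric.closedBall (0 : EuclideanSpace ℝ (Fin d)) 1) * |∏ i, shape x i i| = 1 := by
  rw [volume_solid, ← ENNReal.ofReal_toReal (a := volume _) measure_closedBall_lt_top.ne,
    ← ENNReal.ofReal_mul (abs_nonneg _), ENNReal.ofReal_eq_one, mul_comm]
  rfl

lemma isEllipsoid_solid {x : CenterShape d} (hx : ∏ i, shape x i i ≠ 0) : IsEllipsoid x.solid := by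
  have hdet : LinearMap.det (Matrix.toLpLin 2 2 (shape x)) ≠ 0 := by
    rwa [LinearMap.det_toLpLin, det_shape]
  refine ⟨(LinearMap.equivOfDetNeZero _ hdet).toAffineEquiv.trans
    (AffineEquiv.constVAdd ℝ _ (center x)), ?_⟩
  rw [solid]
  rfl

/-- The center and shape pairs whose solid lies in `C`. -/
def inside (C : Set (EuclideanSpace ℝ (Fin d))) : Set (CenterShape d) := {x | x.solid ⊆ C}

lemma inside_eq_iInter (C : Set (EuclideanSpace ℝ (Fin d))) :
    inside C = ⋂ b ∈ Metric.closedBall (0 : EuclideanSpace ℝ (Fin d)) 1, pointAt b ⁻¹' C := by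
  ext x
  simp only [inside, solid, Set.mem_ofPred_eq, Set.image_subset_iff, Set.mem_iInter]
  rfl

lemma convex_inside {C : Set (EuclideanSpace ℝ (Fin d))} (hC : Convex ℝ C) :
    Convex ℝ (inside C) := by
  rw [inside_eq_iInter]
  exact convex_iInter₂ fun b _ => hC.linear_preimage (pointAt b)

lemma isClosed_inside {C : Set (EuclideanSpace ℝ (Fin d))} (hC : IsClosed C) :
    IsClosed (inside C) := by
  rw [inside_eq_iInter]
  exact isClosed_biInter fun b _ => hC.preimage (pointAt b).continuous_of_finiteDimensional

/-- Pairs with nonnegative diagonal entries whose solid has volume at least one. -/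
def large (d : ℕ) : Set (CenterShape d) :=
  {x | (∀ i, 0 ≤ shape x i i) ∧
    1 ≤ volume.real (Metric.closedBall (0 : EuclideanSpace ℝ (Fin d)) 1) * ∏ i, shape x i i}

lemma isClosed_large : IsClosed (large d) := by
  have hc : ∀ i : Fin d, Continuous fun x : CenterShape d => shape x i i := fun i =>
    ((LinearMap.proj i).comp ((LinearMap.proj i).comp shape :
      CenterShape d →ₗ[ℝ] (Fin d → ℝ))).continuous_of_finiteDimensional
  refine IsClosed.inter (s₁ := {x | ∀ i, 0 ≤ shape x i i}) ?_ ?_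
  · rw [Set.ofPred_forall]
    exact isClosed_iInter fun i => isClosed_le continuous_const (hc i)
  · exact isClosed_le continuous_const
      (continuous_const.mul (continuous_finsetProd _ fun i _ => hc i))

end CenterShape

/-- The geometric mean is superadditive: the set of nonnegative vectors whose product of
coordinates is at least `v` is convex. -/
lemma le_prod_convex_combination {ι : Type*} [Fintype ι] {v : ℝ} (hv : 0 < v) {x y : ι → ℝ}
    (hx : ∀ i, 0 ≤ x i) (hy : ∀ i, 0 ≤ y i) (hvx : v ≤ ∏ i, x i) (hvy : v ≤ ∏ i, y i) {a b : ℝ}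
    (ha : 0 ≤ a) (hb : 0 ≤ b) (hab : a + b = 1) : v ≤ ∏ i, (a * x i + b * y i) :=
  calc v = v ^ a * v ^ b := by rw [← Real.rpow_add hv, hab, Real.rpow_one]
    _ ≤ (∏ i, x i) ^ a * (∏ i, y i) ^ b := by
        have := Finset.prod_nonneg fun i (_ : i ∈ Finset.univ) => hx i
        gcongr
    _ = ∏ i, (x i ^ a * y i ^ b) := by
        rw [Finset.prod_mul_distrib, Real.finsetProd_rpow _ _ fun i _ => hx i,
          Real.finsetProd_rpow _ _ fun i _ => hy i]
    _ ≤ ∏ i, (a * x i + b * y i) :=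
        Finset.prod_le_prod
          (fun i _ => mul_nonneg (Real.rpow_nonneg (hx i) _) (Real.rpow_nonneg (hy i) _))
          fun i _ => Real.geom_mean_le_arith_mean2_weighted ha hb (hx i) (hy i) hab

namespace CenterShape

variable {d : ℕ}

lemma convex_large : Convex ℝ (large d) := by
  intro x hx y hy a b ha hb hab
  have hpos := volume_closedBall_pos (d := d)
  have hdiag : ∀ i, shape (a • x + b • y) i i = a * shape x i i + b * shape y i i := fun i => by
    simp
  refine ⟨fun i => ?_, ?_⟩
  · rw [hdiag]
    have := hx.1 i
    have := hy.1 i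
    positivity
  · simp only [hdiag]
    rw [← div_le_iff₀' hpos]
    exact le_prod_convex_combination (by positivity) hx.1 hy.1
      ((div_le_iff₀' hpos).2 hx.2) ((div_le_iff₀' hpos).2 hy.2) ha hb hab

/-- The degenerate pair with the same center and zero shape. -/
def collapse (x : CenterShape d) : CenterShape d :=
  WithLp.toLp 2 (Sum.elim (fun i => x (Sum.inl i)) 0)

@[simp] lemma center_collapse (x : CenterShape d) : center (collapse x) = center x := by
  ext i
  simp [center, collapse]

@[simp] lemma shape_collapse (x : CenterShape d) : shape (collapse x) = 0 := by
  ext i j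
  simp [shape, collapse]

lemma collapse_mem_inside {C : Set (EuclideanSpace ℝ (Fin d))} {x : CenterShape d}
    (hx : x ∈ inside C) : collapse x ∈ inside C := by
  rintro _ ⟨b, -, rfl⟩
  exact hx ⟨0, by simp, by simp [pointAt_apply]⟩

lemma inner_collapse_sub_neg (hd : 1 ≤ d) {x : CenterShape d} (hx : x ∈ large d) :
    inner ℝ x (collapse x - x) < 0 := by
  have hprod : ∏ i, shape x i i ≠ 0 := fun h => by
    have := hx.2
    rw [h, mul_zero] at this
    linarith
  have hne : shape x ⟨0, hd⟩ ⟨0, hd⟩ ≠ 0 := Finset.prod_ne_zero_iff.1 hprod _ (Finset.mem_univ _)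
  rw [PiLp.inner_apply, Fintype.sum_sum_type]
  have h1 : ∀ i, inner ℝ (x (Sum.inl i)) ((collapse x - x) (Sum.inl i)) = 0 := by
    simp [collapse]
  simp only [h1, Finset.sum_const_zero, zero_add]
  have h2 : ∀ p, inner ℝ (x (Sum.inr p)) ((collapse x - x) (Sum.inr p)) = -(x (Sum.inr p)) ^ 2 := by
    intro p
    simp [collapse]
    ring
  simp only [h2]
  refine Finset.sum_neg' (fun p _ => by simpa using sq_nonneg _)
    ⟨⟨⟨0, hd⟩, ⟨0, by simp⟩⟩, Finset.mem_univ _, ?_⟩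
  have : x (Sum.inr ⟨⟨0, hd⟩, ⟨0, by simp⟩⟩) ≠ 0 := by simpa [shape] using hne
  exact neg_neg_of_pos (by positivity)

/-- A solid of volume at least one contains a homothetic copy, with the same center, of volume
exactly one. -/
lemma exists_isEllipsoid_of_mem_large (hd : 1 ≤ d) {x : CenterShape d} (hx : x ∈ large d) :
    ∃ E, IsEllipsoid E ∧ volume E = 1 ∧ ∀ C, Convex ℝ C → x ∈ inside C → E ⊆ C := by
  set p := volume.real (Metric.closedBall (0 : EuclideanSpace ℝ (Fin d)) 1) * ∏ i, shape x i i
  have hp : 1 ≤ p := hx.2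
  obtain ⟨t, ht0, ht1, htp⟩ : ∃ t : ℝ, 0 ≤ t ∧ t ≤ 1 ∧ t ^ d * p = 1 := by
    refine ⟨(p⁻¹) ^ ((d : ℝ)⁻¹), by positivity,
      Real.rpow_le_one (by positivity) (inv_le_one_of_one_le₀ hp) (by positivity), ?_⟩
    rw [Real.rpow_inv_natCast_pow (by positivity) (by omega), inv_mul_cancel₀ (by positivity)]
  set y := t • x + (1 - t) • collapse x
  have hy : ∏ i, shape y i i = t ^ d * ∏ i, shape x i i := by
    simp [y, Finset.prod_mul_distrib]
  have hy1 : volume.real (Metric.closedBall (0 : EuclideanSpace ℝ (Fin d)) 1) *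
      ∏ i, shape y i i = 1 := by
    rw [hy, mul_left_comm]
    exact htp
  have hy0 : 0 ≤ ∏ i, shape y i i := by
    rw [hy]
    exact mul_nonneg (by positivity) (Finset.prod_nonneg fun i _ => hx.1 i)
  refine ⟨y.solid, isEllipsoid_solid fun h => by simp [h] at hy1, ?_, fun C hC hxC => ?_⟩
  · rw [volume_solid_eq_one_iff, abs_of_nonneg hy0, hy1]
  · exact convex_inside hC hxC (collapse_mem_inside hxC) ht0 (by linarith) (by ring)

/-- Every linear image of the ball is the image of the ball under a lower triangular matrix with
nonnegative diagonal. -/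
lemma exists_isLowerTriangular_image_closedBall
    (A : EuclideanSpace ℝ (Fin d) →ₗ[ℝ] EuclideanSpace ℝ (Fin d)) :
    ∃ L : Matrix (Fin d) (Fin d) ℝ, L.IsLowerTriangular ∧ (∀ i, 0 ≤ L i i) ∧
      A '' Metric.closedBall 0 1 = Matrix.toLpLin 2 2 L '' Metric.closedBall 0 1 := by
  set f : Fin d → EuclideanSpace ℝ (Fin d) := fun i =>
    LinearMap.adjoint A (EuclideanSpace.single i 1)
  set q := InnerProductSpace.gramSchmidtOrthonormalBasis (𝕜 := ℝ) (by simp) f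
  have hA : ∀ b, A b = Matrix.toLpLin 2 2 (Matrix.of fun i j => inner ℝ (f i) (q j)) (q.repr b) := by
    intro b
    ext i
    have h1 : A b i = inner ℝ (f i) b := by
      simp [f, LinearMap.adjoint_inner_left, EuclideanSpace.inner_single_left]
    rw [h1, ← q.sum_inner_mul_inner]
    simp [Matrix.mulVec, dotProduct, OrthonormalBasis.repr_apply_apply]
  refine ⟨Matrix.of fun i j => inner ℝ (f i) (q j), fun i j hij => ?_, fun i => ?_, ?_⟩
  · rw [Matrix.of_apply, real_inner_comm]
    exact InnerProductSpace.gramSchmidtOrthonormalBasis_inv_triangular _ f hij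
  · rw [Matrix.of_apply, real_inner_comm]
    by_cases hi : InnerProductSpace.gramSchmidtNormed ℝ f i = 0
    · exact (InnerProductSpace.inner_gramSchmidtOrthonormalBasis_eq_zero _ hi i).ge
    · rw [InnerProductSpace.gramSchmidtOrthonormalBasis_apply _ hi,
        InnerProductSpace.gramSchmidtNormed, inner_smul_left]
      refine mul_nonneg (by simp) ?_
      conv_rhs => rw [InnerProductSpace.gramSchmidt_def'' ℝ f i]
      rw [inner_add_right, inner_sum, Finset.sum_eq_zero, add_zero]
      · exact real_inner_self_nonneg
      · intro j hj
        rw [inner_smul_right, InnerProductSpace.gramSchmidt_orthogonal ℝ f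
          (Finset.mem_Iio.1 hj).ne', mul_zero]
  · rw [show (A : _ → _) = _ ∘ q.repr from funext hA, Set.image_comp,
      LinearIsometryEquiv.image_closedBall, map_zero]

lemma exists_mem_large_solid_eq {E : Set (EuclideanSpace ℝ (Fin d))} (hE : IsEllipsoid E)
    (hvol : volume E = 1) : ∃ x ∈ large d, x.solid = E := by
  obtain ⟨A, rfl⟩ := hE
  obtain ⟨L, hL, hdiag, himg⟩ :=
    exists_isLowerTriangular_image_closedBall (A.linear : _ →ₗ[ℝ] EuclideanSpace ℝ (Fin d))
  obtain ⟨x, hc, hs⟩ := exists_center_shape_eq (A 0) hL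
  have hx : x.solid = A '' Metric.closedBall 0 1 := by
    rw [solid_eq, hs, hc, ← himg, Set.image_image]
    refine Set.image_congr fun b _ => ?_
    have := A.map_vadd 0 b
    simp only [vadd_eq_add, add_zero] at this
    rw [this, add_comm]
    rfl
  refine ⟨x, ⟨fun i => hs ▸ hdiag i, ?_⟩, hx⟩
  rw [← hx, volume_solid_eq_one_iff,
    abs_of_nonneg (Finset.prod_nonneg fun i _ => hs ▸ hdiag i)] at hvol
  exact hvol.ge

end CenterShape

open CenterShape

/-- Quantitative Fractional Helly Theorem for large subfamilies. -/
theorem quantitative_fractional_helly_large_subfamilies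
    (d : ℕ) (hd : 1 ≤ d) (α : ℝ) (hα : α ∈ Set.Ioo (0 : ℝ) 1)
    (n : ℕ) (hn : d * (d + 3) / 2 ≤ n)
    (C : Fin n → Set (EuclideanSpace ℝ (Fin d)))
    (hconv : ∀ i, Convex ℝ (C i))
    (hcpt : ∀ i, IsCompact (C i))
    (hint : ∀ i, (interior (C i)).Nonempty)
    (hfrac : α * (n.choose (d * (d + 3) / 2) : ℝ) ≤
      ({S : Finset (Fin n) | S.card = d * (d + 3) / 2 ∧
          ∃ E, IsEllipsoid E ∧ volume E = 1 ∧ E ⊆ ⋂ i ∈ S, C i}.ncard : ℝ)) :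
    ∃ C' : Finset (Fin n),
      (2 * α / (d * (d + 3)) : ℝ) * (n : ℝ) ≤ (C'.card : ℝ) ∧
      ∃ E, IsEllipsoid E ∧ volume E = 1 ∧ E ⊆ ⋂ i ∈ C', C i := by
  classical
  have hk : 1 ≤ d * (d + 3) / 2 := by
    rw [Nat.le_div_iff_mul_le two_pos]
    nlinarith
  have hkcast : 2 * α / (d * (d + 3)) = α / ((d * (d + 3) / 2 : ℕ) : ℝ) := by
    have h2 : 2 ∣ d * (d + 3) := by
      rcases Nat.even_or_odd d with h | h
      · exact h.two_dvd.mul_right _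
      · exact (h.add_odd (by decide)).two_dvd.mul_left _
    rw [Nat.cast_div h2 (by norm_num)]
    push_cast
    field_simp
  have hmin : ∀ T : Finset (Fin n), ∃ e : CenterShape d,
      (∃ x ∈ large d, ∀ i ∈ T, x ∈ inside (C i)) → (e ∈ large d ∧ ∀ i ∈ T, e ∈ inside (C i)) ∧
        ∀ x ∈ large d, (∀ i ∈ T, x ∈ inside (C i)) → 0 ≤ inner ℝ e (x - e) := by
    intro T
    by_cases hne : ∃ x ∈ large d, ∀ i ∈ T, x ∈ inside (C i)
    · obtain ⟨x, hx, hxT⟩ := hne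
      obtain ⟨e, he, hmin⟩ := exists_forall_inner_sub_nonneg
        (K := large d ∩ ⋂ i ∈ T, inside (C i)) ⟨x, hx, Set.mem_iInter₂.2 hxT⟩
        (isClosed_large.inter (isClosed_biInter fun i _ => isClosed_inside (hcpt i).isClosed))
        (convex_large.inter (convex_iInter₂ fun i _ => convex_inside (hconv i)))
      exact ⟨e, fun _ => ⟨⟨he.1, Set.mem_iInter₂.1 he.2⟩,
        fun x hx hxT => hmin x ⟨hx, Set.mem_iInter₂.2 hxT⟩⟩⟩
    · exact ⟨0, fun h => absurd h hne⟩
  choose m hm using hmin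
  have herase : ∀ S : Finset (Fin n), ∃ j : Fin n, S.card = d * (d + 3) / 2 ∧
      (∃ E, IsEllipsoid E ∧ volume E = 1 ∧ E ⊆ ⋂ i ∈ S, C i) →
      j ∈ S ∧ m (S.erase j) ∈ large d ∧ ∀ i ∈ S, m (S.erase j) ∈ inside (C i) := by
    intro S
    by_cases hS : S.card = d * (d + 3) / 2 ∧
      ∃ E, IsEllipsoid E ∧ volume E = 1 ∧ E ⊆ ⋂ i ∈ S, C i
    · obtain ⟨hcard, E, hE, hvol, hES⟩ := hS
      obtain ⟨x, hx, rfl⟩ := exists_mem_large_solid_eq hE hvol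
      obtain ⟨j, hj, h⟩ := exists_leastNorm_erase_mem (P := fun i => inside (C i))
        (fun i => convex_inside (hconv i)) convex_large collapse (fun i x => collapse_mem_inside)
        (fun x => inner_collapse_sub_neg hd) m hm S (by rw [finrank_eq, hcard])
        ⟨x, hx, fun i hi => hES.trans (Set.biInter_subset_of_mem hi)⟩
      exact ⟨j, fun _ => ⟨hj, h⟩⟩
    · exact ⟨⟨0, hk.trans hn⟩, fun h => absurd h hS⟩
  choose j hj using herase
  set G : Finset (Finset (Fin n)) := {S | S.card = d * (d + 3) / 2 ∧
    ∃ E, IsEllipsoid E ∧ volume E = 1 ∧ E ⊆ ⋂ i ∈ S, C i}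
  have hG : ∀ S ∈ G, S.card = d * (d + 3) / 2 ∧
      ∃ E, IsEllipsoid E ∧ volume E = 1 ∧ E ⊆ ⋂ i ∈ S, C i := fun S hS =>
    (Finset.mem_filter.1 hS).2
  rw [← Finset.coe_filter_univ, Set.ncard_coe_finset] at hfrac
  obtain ⟨S, hS, hcard⟩ := exists_card_ge_of_erase_determines hk hn hα.1 hα.2.le G
    (fun S hS => (hG S hS).1) hfrac j (fun S hS => (hj S (hG S hS)).1)
    (fun B => {i | m B ∈ inside (C i)})
    fun S hS i hi => by simpa using (hj S (hG S hS)).2.2 i hi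
  obtain ⟨E, hE, hvol, hEC⟩ := exists_isEllipsoid_of_mem_large hd (hj S (hG S hS)).2.1
  refine ⟨_, hkcast ▸ hcard, E, hE, hvol, Set.subset_iInter₂ fun i hi => ?_⟩
  exact hEC _ (hconv i) (Finset.mem_filter.1 hi).2
end
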